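/- arXiv:2207.01715 — 2 statements merged into one kernel-verified Lean document; each statement's English description precedes it below -/
import Mathlib

section
/- Work on ℤ². For N ≥ 1 let Λ_N = {−N,…,N}², and let μ⁺_{β,N} be the plus-boundary Ising measure on {−1,1}^{Λ_N}: μ⁺_{β,N}(σ) is proportional to exp(β [Σ σ_u σ_v + Σ' σ_u]), where the first sum is over unordered pairs {u,v} ⊆ Λ_N with ‖u−v‖₁ = 1 and the second sum Σ' is over pairs (u,v) with u ∈ Λ_N, v ∈ ℤ² ∖ Λ_N and ‖u−v‖₁ = 1. Define m_N(β) = E_{μ⁺_{β,N}}[σ_0], m*(β) = limsup_{N→∞} m_N(β), and β_c = inf{β ≥ 0 : m*(β) > 0}. Then β_c = ½ log(1 + √2) = log √(1+√2): that is, m*(β) = 0 for every β < ½ log(1+√2) and m*(β) > 0 for every β > ½ log(1+√2). -/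
open scoped Classical
open Filter

noncomputable section

/-- The spin value `±1` attached to a Boolean. -/
def spin (b : Bool) : ℝ := if b then 1 else -1

/-- The `ℓ¹`-distance on `ℤ^d`. -/
def dist1 {d : ℕ} (u v : Fin d → ℤ) : ℤ := ∑ i, |u i - v i|

/-- The box `Λ_N = {-N,…,N}^d ⊆ ℤ^d`. -/
def cube (d N : ℕ) : Finset (Fin d → ℤ) :=
  Fintype.piFinset fun _ => Finset.Icc (-(N : ℤ)) N

/-- The set of nearest neighbours of `u` in `ℤ^d`. -/
def nbrs {d : ℕ} (u : Fin d → ℤ) : Finset (Fin d → ℤ) :=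
  (Fintype.piFinset fun i => Finset.Icc (u i - 1) (u i + 1)).filter fun v => dist1 u v = 1

/-- The number of nearest neighbours of `u` lying outside `Λ_N` (counted with
multiplicity). -/
def bCount (d N : ℕ) (u : Fin d → ℤ) : ℕ := (nbrs u \ cube d N).card

/-- The plus-boundary Ising Boltzmann weight
`exp(β[∑_{{u,v}⊆Λ_N, ‖u-v‖₁=1} σ_u σ_v + ∑_{u∈Λ_N, v∉Λ_N, ‖u-v‖₁=1} σ_u])` of a
configuration `σ ∈ {-1,1}^{Λ_N}` (the sum over unordered pairs is written as half the sum
over ordered pairs). -/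
def plusWeight (d N : ℕ) (β : ℝ) (σ : {x // x ∈ cube d N} → Bool) : ℝ :=
  Real.exp (β * ((1 / 2) * (∑ u ∈ (cube d N).attach, ∑ v ∈ (cube d N).attach,
      if dist1 (u : Fin d → ℤ) (v : Fin d → ℤ) = 1 then spin (σ u) * spin (σ v) else 0) +
    ∑ u ∈ (cube d N).attach, (bCount d N (u : Fin d → ℤ) : ℝ) * spin (σ u)))

lemma origin_mem_cube (d N : ℕ) : (fun _ => (0 : ℤ)) ∈ cube d N := by
  simp only [cube, Fintype.mem_piFinset, Finset.mem_Icc]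
  intro i
  omega

/-- `m_N(β)`: the expected spin at the origin under the plus-boundary Ising measure on
`Λ_N`. -/
def mag (d N : ℕ) (β : ℝ) : ℝ :=
  (∑ σ : {x // x ∈ cube d N} → Bool,
      plusWeight d N β σ * spin (σ ⟨fun _ => 0, origin_mem_cube d N⟩)) /
    ∑ σ : {x // x ∈ cube d N} → Bool, plusWeight d N β σ

/-- The spontaneous magnetisation `m*(β) = limsup_N m_N(β)`. -/
def mstar (d : ℕ) (β : ℝ) : ℝ := atTop.limsup fun N => mag d N β

end

/-- A vertex of the square lattice. -/
abbrev Site := ℤ × ℤ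

/-- An edge of the square lattice: `(u, false)` joins `u` to its right neighbour and `(u, true)`
joins `u` to its upper neighbour. -/
abbrev Bond := Site × Bool

/-- The four edges at `u`, in the order south, east, north, west. -/
def bond (u : Site) : Fin 4 → Bond :=
  ![((u.1, u.2 - 1), true), (u, false), (u, true), ((u.1 - 1, u.2), false)]

/-- The four neighbours of `u`, in the order south, east, north, west. -/
def nb (u : Site) : Fin 4 → Site :=
  ![(u.1, u.2 - 1), (u.1 + 1, u.2), (u.1, u.2 + 1), (u.1 - 1, u.2)]

/-- The opposite direction. -/
def op : Fin 4 → Fin 4 := ![2, 3, 0, 1]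

lemma bond_nb (u : Site) (i : Fin 4) : bond (nb u i) (op i) = bond u i := by
  fin_cases i <;> simp [bond, nb, op]

lemma nb_nb (u : Site) (i : Fin 4) : nb (nb u i) (op i) = u := by
  fin_cases i <;> simp [nb, op]

lemma op_op (i : Fin 4) : op (op i) = i := by
  fin_cases i <;> simp [op]

/-- The antisymmetric sign matrix which propagates the fermionic observable through a vertex. -/
def turn (j i : Fin 4) : ℝ := if i < j then -1 else if j < i then 1 else 0

lemma sum_turn_sq_le (b : Fin 4 → ℝ) :
    ∑ j, (∑ i, turn j i * b i) ^ 2 ≤ (1 + √2) ^ 2 * ∑ i, b i ^ 2 := by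
  have h2 : √2 ^ 2 = 2 := Real.sq_sqrt (by norm_num)
  have hp : 0 < √2 := by positivity
  have key : 0 ≤ 2 * √2 *
      ((b 1 - √2 / 2 * (b 0 + b 2)) ^ 2 + (b 3 - √2 / 2 * (b 2 - b 0)) ^ 2) := by
    positivity
  have e : (1 + √2) ^ 2 * ∑ i, b i ^ 2 - ∑ j, (∑ i, turn j i * b i) ^ 2 =
      2 * √2 * ((b 1 - √2 / 2 * (b 0 + b 2)) ^ 2 + (b 3 - √2 / 2 * (b 2 - b 0)) ^ 2) := by
    simp only [Fin.sum_univ_four, turn]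
    norm_num [Fin.lt_def]
    have h3 : √2 ^ 3 = 2 * √2 := by rw [pow_succ, h2]
    ring_nf
    rw [h3, h2]
    ring
  linarith

lemma add_sq_le_of_pos {η : ℝ} (hη : 0 < η) (p q : ℝ) :
    (p + q) ^ 2 ≤ (1 + η) * p ^ 2 + (1 + 1 / η) * q ^ 2 := by
  have h : (1 + η) * p ^ 2 + (1 + 1 / η) * q ^ 2 - (p + q) ^ 2 = (η * p - q) ^ 2 / η := by
    field_simp; ring
  have : 0 ≤ (η * p - q) ^ 2 / η := by positivity
  linarith

lemma sum_nb_le {V : Finset Site} {g : Site → Fin 4 → ℝ} (hg : ∀ u j, 0 ≤ g u j)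
    (hV : ∀ u ∉ V, ∀ j, g u j = 0) :
    ∑ u ∈ V, ∑ i, g (nb u i) (op i) ≤ ∑ u ∈ V, ∑ j, g u j := by
  rw [← Finset.sum_product', ← Finset.sum_product']
  have hinj : Function.Injective fun p : Site × Fin 4 => (nb p.1 p.2, op p.2) := by
    rintro ⟨u, i⟩ ⟨v, j⟩ hp
    simp only [Prod.mk.injEq] at hp
    have hij : i = j := by rw [← op_op i, hp.2, op_op]
    subst hij
    rw [← nb_nb u i, hp.1, nb_nb]
  rw [← Finset.sum_image (s := V ×ˢ Finset.univ) (f := fun p : Site × Fin 4 => g p.1 p.2)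
    hinj.injOn, ← Finset.sum_filter_ne_zero]
  refine Finset.sum_le_sum_of_subset_of_nonneg (fun p hp => ?_) fun _ _ _ => hg _ _
  simp only [Finset.mem_product, Finset.mem_univ, and_true]
  by_contra hpV
  exact (Finset.mem_filter.1 hp).2 (hV _ hpV _)

/-- A weighted `ℓ²` bound for solutions of the Kac-Ward equation with edge weights at most `x`. -/
lemma exists_energy_bound {x μ : ℝ} (hx : 0 ≤ x) (hμ : 0 < μ) (h : (1 + √2) * (x * μ) < 1) :
    ∃ K > 0, ∀ (V : Finset Site) (f b r : Site → Fin 4 → ℝ) (s q : Site → ℝ),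
      (∀ u ∉ V, ∀ j, f u j = 0) →
      (∀ u j, f u j = ∑ i, turn j i * b u i + s u) →
      (∀ u i, |b u i| ≤ x * (|f (nb u i) (op i)| + r u i)) →
      (∀ u, 0 < q u) → (∀ u i, q u ≤ μ * q (nb u i)) →
      ∑ u ∈ V, ∑ j, (q u * f u j) ^ 2 ≤
        K * ∑ u ∈ V, q u ^ 2 * (s u ^ 2 + ∑ i, r u i ^ 2) := by
  set ρ := (1 + √2) * (x * μ) with hρ
  have hρ0 : 0 ≤ ρ := by positivity
  obtain ⟨η, hη, hηρ⟩ : ∃ η > 0, (1 + η) * ρ < 1 := by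
    refine ⟨(1 - ρ) / 2, by linarith, by nlinarith⟩
  have hT : (1 + η) ^ 2 * ρ ^ 2 < 1 := by
    rw [← mul_pow]; exact pow_lt_one₀ (by positivity) hηρ two_ne_zero
  set C := 4 * (1 + 1 / η) + (1 + η) * ((1 + √2) ^ 2 * (x ^ 2 * (1 + 1 / η))) with hC
  have hCp : 0 < C := by positivity
  refine ⟨C / (1 - (1 + η) ^ 2 * ρ ^ 2), div_pos hCp (by linarith), ?_⟩
  intro V f b r s q hV hf hb hq hqμ
  set X := ∑ u ∈ V, ∑ j, (q u * f u j) ^ 2 with hX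
  set Y := ∑ u ∈ V, q u ^ 2 * (s u ^ 2 + ∑ i, r u i ^ 2) with hY
  have hbs : ∀ u i, b u i ^ 2 ≤
      x ^ 2 * ((1 + η) * f (nb u i) (op i) ^ 2 + (1 + 1 / η) * r u i ^ 2) := by
    intro u i
    calc b u i ^ 2 = |b u i| ^ 2 := (sq_abs _).symm
      _ ≤ (x * (|f (nb u i) (op i)| + r u i)) ^ 2 := by
          exact pow_le_pow_left₀ (abs_nonneg _) (hb u i) 2
      _ = x ^ 2 * (|f (nb u i) (op i)| + r u i) ^ 2 := by ring
      _ ≤ _ := by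
          gcongr
          have := add_sq_le_of_pos hη |f (nb u i) (op i)| (r u i)
          rwa [sq_abs] at this
  have hpt : ∀ u, ∑ j, (q u * f u j) ^ 2 ≤
      (1 + η) ^ 2 * ρ ^ 2 * ∑ i, (q (nb u i) * f (nb u i) (op i)) ^ 2 +
      C * (q u ^ 2 * (s u ^ 2 + ∑ i, r u i ^ 2)) := by
    intro u
    have h1 : ∑ j, f u j ^ 2 ≤ (1 + η) * ((1 + √2) ^ 2 * ∑ i, b u i ^ 2) +
        4 * (1 + 1 / η) * s u ^ 2 := by
      calc ∑ j, f u j ^ 2 ≤ ∑ j, ((1 + η) * (∑ i, turn j i * b u i) ^ 2 +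
            (1 + 1 / η) * s u ^ 2) := by
            refine Finset.sum_le_sum fun j _ => ?_
            rw [hf u j]; exact add_sq_le_of_pos hη _ _
        _ = (1 + η) * ∑ j, (∑ i, turn j i * b u i) ^ 2 + 4 * (1 + 1 / η) * s u ^ 2 := by
            rw [Finset.sum_add_distrib, ← Finset.mul_sum]; simp; ring
        _ ≤ _ := by gcongr; exact sum_turn_sq_le _
    have h2 : ∑ i, b u i ^ 2 ≤ x ^ 2 * ((1 + η) * ∑ i, f (nb u i) (op i) ^ 2 +
        (1 + 1 / η) * ∑ i, r u i ^ 2) := by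
      calc _ ≤ ∑ i, x ^ 2 * ((1 + η) * f (nb u i) (op i) ^ 2 + (1 + 1 / η) * r u i ^ 2) :=
            Finset.sum_le_sum fun i _ => hbs u i
        _ = _ := by rw [← Finset.mul_sum, Finset.sum_add_distrib, Finset.mul_sum, Finset.mul_sum]
    have h3 : q u ^ 2 * ∑ i, f (nb u i) (op i) ^ 2 ≤
        μ ^ 2 * ∑ i, (q (nb u i) * f (nb u i) (op i)) ^ 2 := by
      rw [Finset.mul_sum, Finset.mul_sum]
      refine Finset.sum_le_sum fun i _ => ?_
      calc q u ^ 2 * f (nb u i) (op i) ^ 2 ≤ (μ * q (nb u i)) ^ 2 * f (nb u i) (op i) ^ 2 := by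
            gcongr
            · exact (hq u).le
            · exact hqμ u i
        _ = _ := by ring
    have hR : 0 ≤ ∑ i, r u i ^ 2 := by positivity
    have hS : 0 ≤ s u ^ 2 := by positivity
    have e1 : ∑ j, (q u * f u j) ^ 2 = q u ^ 2 * ∑ j, f u j ^ 2 := by
      rw [Finset.mul_sum]; simp only [mul_pow]
    rw [e1]
    calc q u ^ 2 * ∑ j, f u j ^ 2 ≤ q u ^ 2 * ((1 + η) * ((1 + √2) ^ 2 *
          (x ^ 2 * ((1 + η) * ∑ i, f (nb u i) (op i) ^ 2 + (1 + 1 / η) * ∑ i, r u i ^ 2))) +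
          4 * (1 + 1 / η) * s u ^ 2) := by
          gcongr
          exact h1.trans (by gcongr)
      _ = (1 + η) ^ 2 * ((1 + √2) ^ 2 * x ^ 2) * (q u ^ 2 * ∑ i, f (nb u i) (op i) ^ 2) +
          q u ^ 2 * ((1 + η) * ((1 + √2) ^ 2 * (x ^ 2 * (1 + 1 / η))) * ∑ i, r u i ^ 2 +
            4 * (1 + 1 / η) * s u ^ 2) := by ring
      _ ≤ (1 + η) ^ 2 * ((1 + √2) ^ 2 * x ^ 2) *
            (μ ^ 2 * ∑ i, (q (nb u i) * f (nb u i) (op i)) ^ 2) +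
          q u ^ 2 * (C * ∑ i, r u i ^ 2 + C * s u ^ 2) := by
          gcongr
          · rw [hC]; have : 0 ≤ 4 * (1 + 1 / η) := by positivity
            linarith
          · rw [hC]
            have : 0 ≤ (1 + η) * ((1 + √2) ^ 2 * (x ^ 2 * (1 + 1 / η))) := by positivity
            linarith
      _ = _ := by rw [hρ]; ring
  have hre : ∑ u ∈ V, ∑ i, (q (nb u i) * f (nb u i) (op i)) ^ 2 ≤ X :=
    sum_nb_le (g := fun u j => (q u * f u j) ^ 2) (fun _ _ => sq_nonneg _)
      fun u hu j => by rw [hV u hu j]; ring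
  have hfin : X ≤ (1 + η) ^ 2 * ρ ^ 2 * X + C * Y := by
    calc X ≤ ∑ u ∈ V, ((1 + η) ^ 2 * ρ ^ 2 * ∑ i, (q (nb u i) * f (nb u i) (op i)) ^ 2 +
        C * (q u ^ 2 * (s u ^ 2 + ∑ i, r u i ^ 2))) := Finset.sum_le_sum fun u _ => hpt u
      _ = (1 + η) ^ 2 * ρ ^ 2 * ∑ u ∈ V, ∑ i, (q (nb u i) * f (nb u i) (op i)) ^ 2 + C * Y := by
        rw [Finset.sum_add_distrib, ← Finset.mul_sum, ← Finset.mul_sum]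
      _ ≤ _ := by gcongr
  rw [div_mul_eq_mul_div, le_div_iff₀ (by linarith)]
  linarith

lemma zmod_two_cases (z : ZMod 2) : z = 0 ∨ z = 1 := by
  revert z; decide

/-- The indicator of `e ∈ E` modulo two. -/
def ind (E : Finset Bond) (e : Bond) : ZMod 2 := if e ∈ E then 1 else 0

/-- The degree of `u` in `E` modulo two. -/
def par (E : Finset Bond) (u : Site) : ZMod 2 := ∑ i, ind E (bond u i)

/-- The indicator of the vertical edges which cross the leftward ray from the face at the
south-west of `u`. -/
def ray (u : Site) (e : Bond) : ZMod 2 :=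
  if e.2 = true ∧ e.1.2 = u.2 - 1 ∧ e.1.1 < u.1 then 1 else 0

/-- The indicator of the edges crossed by the leftward ray from the face at the south-west of `u`,
preceded by the edges at `u` before the direction `j`. -/
def cut (u : Site) (j : Fin 4) (e : Bond) : ZMod 2 :=
  ray u e + ∑ i, if i < j ∧ e = bond u i then 1 else 0

/-- The sign character of `ZMod 2`. -/
noncomputable def sg (z : ZMod 2) : ℝ := if z = 0 then 1 else -1

lemma sg_zero : sg 0 = 1 := by simp [sg]

lemma sg_one : sg 1 = -1 := by simp [sg]

lemma sg_add (y z : ZMod 2) : sg (y + z) = sg y * sg z := by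
  have h : (1 + 1 : ZMod 2) = 0 := by decide
  rcases zmod_two_cases y with rfl | rfl <;> rcases zmod_two_cases z with rfl | rfl <;>
    simp [sg, h]

lemma abs_sg (z : ZMod 2) : |sg z| = 1 := by
  rcases zmod_two_cases z with rfl | rfl <;> simp [sg]

lemma sg_mul_self (z : ZMod 2) : sg z * sg z = 1 := by
  rcases zmod_two_cases z with rfl | rfl <;> simp [sg]

lemma sg_sum {ι : Type*} (s : Finset ι) (f : ι → ZMod 2) :
    sg (∑ i ∈ s, f i) = ∏ i ∈ s, sg (f i) := by
  induction s using Finset.induction_on with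
  | empty => simp [sg_zero]
  | insert a s ha ih => rw [Finset.sum_insert ha, Finset.prod_insert ha, sg_add, ih]

lemma sum_ite_eq_ind (E : Finset Bond) (e : Bond) :
    ∑ e' ∈ E, (if e' = e then (1 : ZMod 2) else 0) = ind E e := by
  simp [ind]

lemma sum_cut (u : Site) (j : Fin 4) (E : Finset Bond) :
    ∑ e ∈ E, cut u j e = ∑ e ∈ E, ray u e + ∑ i, if i < j then ind E (bond u i) else 0 := by
  simp only [cut, Finset.sum_add_distrib]
  congr 1
  rw [Finset.sum_comm]
  refine Finset.sum_congr rfl fun i _ => ?_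
  by_cases h : i < j <;> simp [h, ind]

lemma ind_insert {E : Finset Bond} {e : Bond} (he : e ∉ E) (e' : Bond) :
    ind (insert e E) e' = ind E e' + if e' = e then 1 else 0 := by
  unfold ind
  by_cases h : e' = e
  · subst h; simp [he]
  · simp [h]

lemma ind_symmDiff (E E' : Finset Bond) (e : Bond) :
    ind (symmDiff E E') e = ind E e + ind E' e := by
  have h : (1 + 1 : ZMod 2) = 0 := by decide
  unfold ind
  by_cases h1 : e ∈ E <;> by_cases h2 : e ∈ E' <;> simp [Finset.mem_symmDiff, h1, h2, h]

lemma par_symmDiff (E E' : Finset Bond) (u : Site) :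
    par (symmDiff E E') u = par E u + par E' u := by
  simp [par, ind_symmDiff, Finset.sum_add_distrib]

lemma par_empty : par ∅ = 0 := by
  ext u; simp [par, ind]

lemma sum_ite_bond_eq (v : Site) (i : Fin 4) (u : Site) :
    (∑ j, if bond u j = bond v i then (1 : ZMod 2) else 0) =
      Pi.single (M := fun _ => ZMod 2) v 1 u + Pi.single (M := fun _ => ZMod 2) (nb v i) 1 u := by
  obtain ⟨x, y⟩ := u
  obtain ⟨a, b⟩ := v
  simp only [Pi.single_apply, Fin.sum_univ_four]
  fin_cases i <;> simp [bond, nb, Prod.ext_iff] <;> split_ifs <;> first | omega | simp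

lemma par_singleton (v : Site) (i : Fin 4) :
    par {bond v i} = Pi.single v 1 + Pi.single (nb v i) 1 := by
  ext u
  rw [Pi.add_apply, ← sum_ite_bond_eq]
  simp [par, ind]

lemma par_insert {E : Finset Bond} {v : Site} {i : Fin 4} (h : bond v i ∉ E) :
    par (insert (bond v i) E) = par E + (Pi.single v 1 + Pi.single (nb v i) 1) := by
  ext u
  rw [Pi.add_apply, Pi.add_apply, ← sum_ite_bond_eq]
  simp [par, ind_insert h, Finset.sum_add_distrib]

lemma ray_add_one (x y : ℤ) (e : Bond) :
    ray (x + 1, y) e = ray (x, y) e + if e = ((x, y - 1), true) then 1 else 0 := by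
  obtain ⟨⟨p, q⟩, b⟩ := e
  simp only [ray, Prod.mk.injEq]
  split_ifs <;> first | simp; done | grind

/-- The edges of `E` crossing a horizontal line are governed by the parities along it. -/
lemma ray_add_ray {E : Finset Bond} {y : ℤ} {A : ℤ} {t : Prop} [Decidable t] {x : ℤ}
    (h : ∀ x' < x, par E (x', y) = if t ∧ x' = A then 1 else 0) :
    ∑ e ∈ E, ray (x, y) e + ∑ e ∈ E, ray (x, y + 1) e + ind E ((x - 1, y), false) =
      if t ∧ A < x then 1 else 0 := by
  obtain ⟨m, hm⟩ : ∃ m : ℤ, m ≤ x ∧ m ≤ A ∧ ∀ e ∈ E, m ≤ e.1.1 := by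
    obtain ⟨m, hm⟩ := (insert x (insert A (E.image fun e => e.1.1))).bddBelow
    exact ⟨m, hm (by simp), hm (by simp), fun e he => hm (by
      simp only [Finset.coe_insert, Finset.coe_image]; exact Or.inr (Or.inr ⟨e, he, rfl⟩))⟩
  have key : ∀ z, m ≤ z → z ≤ x →
      ∑ e ∈ E, ray (z, y) e + ∑ e ∈ E, ray (z, y + 1) e + ind E ((z - 1, y), false) =
      if t ∧ A < z then 1 else 0 := by
    intro z hz
    induction z, hz using Int.leInduction with
    | base =>
      intro _
      have h1 : ∀ w, ∑ e ∈ E, ray (m, w) e = 0 := fun w => Finset.sum_eq_zero fun e he => by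
        have := hm.2.2 e he
        simp only [ray]; rw [if_neg]; rintro ⟨_, _, h3⟩; omega
      have h2 : ind E ((m - 1, y), false) = 0 := by
        simp only [ind]; rw [if_neg]; intro h3
        have := hm.2.2 _ h3; simp at this
      rw [h1, h1, h2, if_neg]
      · simp
      · rintro ⟨_, h3⟩; omega
    | succ z hz ih =>
      intro hzx
      have ih := ih (by omega)
      have hp := h z (by omega)
      simp only [ray_add_one, Finset.sum_add_distrib, sum_ite_eq_ind]
      simp only [par, Fin.sum_univ_four, bond] at hp
      simp only [Matrix.cons_val] at hp
      have e2 : (if t ∧ A < z + 1 then (1 : ZMod 2) else 0) =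
          (if t ∧ A < z then 1 else 0) + if t ∧ z = A then 1 else 0 := by
        split_ifs <;> first | simp; done | grind
      rw [e2, ← ih, ← hp]
      have h2 : ∀ a : ZMod 2, a + a = 0 := by decide
      simp only [add_sub_cancel_right]
      linear_combination (-1) * h2 (ind E ((z - 1, y), false))
  exact key x hm.1 le_rfl

/-- The indicator of a vertex modulo two. -/
def pt (u : Site) : Site → ZMod 2 := Pi.single u 1

lemma pt_self (u : Site) : pt u u = 1 := by simp [pt]

lemma pt_of_ne {u v : Site} (h : v ≠ u) : pt u v = 0 := by simp [pt, h]

lemma pt_add_pt (u : Site) : pt u + pt u = 0 := by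
  ext v
  have h : ∀ z : ZMod 2, z + z = 0 := by decide
  exact h _

/-- The subsets of `G` with sources `A`. -/
noncomputable def conf (G : Finset Bond) (A : Site → ZMod 2) : Finset (Finset Bond) :=
  G.powerset.filter fun E => par E = A

lemma mem_conf {G : Finset Bond} {A : Site → ZMod 2} {E : Finset Bond} :
    E ∈ conf G A ↔ E ⊆ G ∧ par E = A := by simp [conf]

/-- The fermionic observable with source `a`, at `u` in the direction `j` not used by the
configuration. -/
noncomputable def obs (G : Finset Bond) (w : Bond → ℝ) (a u : Site) (j : Fin 4) : ℝ :=
  ∑ E ∈ conf G (pt a + pt u),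
    if bond u j ∈ E then 0 else (∏ e ∈ E, w e) * sg (∑ e ∈ E, cut u j e)

/-- The fermionic observable with source `a`, at `u` in the direction `i` used by the
configuration. -/
noncomputable def obsIn (G : Finset Bond) (w : Bond → ℝ) (a u : Site) (i : Fin 4) : ℝ :=
  ∑ E ∈ conf G (pt a + pt u),
    if bond u i ∈ E then (∏ e ∈ E, w e) * sg (∑ e ∈ E, cut u i e) else 0

/-- The partition function with edge weights `w` and sources `A`. -/
noncomputable def part (G : Finset Bond) (w : Bond → ℝ) (A : Site → ZMod 2) : ℝ :=
  ∑ E ∈ conf G A, ∏ e ∈ E, w e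

lemma local_identity (E : Finset Bond) (u : Site) (j : Fin 4) :
    (if bond u j ∈ E then 0 else sg (∑ e ∈ E, cut u j e)) =
      ∑ i, turn j i * (if bond u i ∈ E then sg (∑ e ∈ E, cut u i e) else 0) +
        if par E u = 0 then sg (∑ e ∈ E, ray u e) else 0 := by
  have htwo : (1 + 1 : ZMod 2) = 0 := by decide
  simp only [sum_cut, sg_add]
  generalize sg (∑ e ∈ E, ray u e) = r
  unfold par
  simp only [ind, Fin.sum_univ_four]
  by_cases h0 : bond u 0 ∈ E <;> by_cases h1 : bond u 1 ∈ E <;> by_cases h2 : bond u 2 ∈ E <;>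
    by_cases h3 : bond u 3 ∈ E <;> simp only [h0, h1, h2, h3, if_true, if_false] <;>
    fin_cases j <;> simp [h0, h1, h2, h3, turn, Fin.lt_def, sg, htwo]

lemma obs_eq (G : Finset Bond) (w : Bond → ℝ) (a u : Site) (j : Fin 4) :
    obs G w a u j = ∑ i, turn j i * obsIn G w a u i +
      if u = a then part G (fun e => w e * sg (ray a e)) 0 else 0 := by
  have h1 : ∀ E ∈ conf G (pt a + pt u),
      (if bond u j ∈ E then 0 else (∏ e ∈ E, w e) * sg (∑ e ∈ E, cut u j e)) =
      ∑ i, turn j i * (if bond u i ∈ E then (∏ e ∈ E, w e) * sg (∑ e ∈ E, cut u i e) else 0) +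
        if u = a then (∏ e ∈ E, w e) * sg (∑ e ∈ E, ray u e) else 0 := by
    intro E hE
    have hp : par E u = 0 ↔ u = a := by
      rw [(mem_conf.1 hE).2, Pi.add_apply, pt_self]
      by_cases h : u = a
      · subst h; simp [pt_self]; decide
      · simp [pt_of_ne h, h]
    have := congrArg (fun z => (∏ e ∈ E, w e) * z) (local_identity E u j)
    simp only [hp, mul_add, Finset.mul_sum, mul_ite, mul_zero] at this ⊢
    rw [this]
    congr 1
    refine Finset.sum_congr rfl fun i _ => ?_
    split_ifs <;> ring
  unfold obs obsIn
  rw [Finset.sum_congr rfl h1, Finset.sum_add_distrib]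
  congr 1
  · rw [Finset.sum_comm]
    simp only [Finset.mul_sum]
  · by_cases h : u = a
    · subst h
      simp only [if_true, pt_add_pt, part, Finset.prod_mul_distrib, sg_sum]
    · simp [h]

/-- The sign change of the observable across an edge. -/
def twist (a u : Site) (i : Fin 4) : ZMod 2 :=
  ![(if a.2 = u.2 - 1 ∧ a.1 < u.1 then 1 else 0) + 1 + pt a (nb u 0), pt a (nb u 1) + 1,
    (if a.2 = u.2 ∧ a.1 < u.1 then 1 else 0) + pt a u, pt a u] i

lemma bond_injective (u : Site) : Function.Injective (bond u) := by
  intro i j h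
  obtain ⟨x, y⟩ := u
  fin_cases i <;> fin_cases j <;> simp [bond] at h ⊢ <;> omega

lemma sum_ray_add_one (E : Finset Bond) (x y : ℤ) :
    ∑ e ∈ E, ray (x + 1, y) e = ∑ e ∈ E, ray (x, y) e + ind E ((x, y - 1), true) := by
  rw [← sum_ite_eq_ind, ← Finset.sum_add_distrib]
  exact Finset.sum_congr rfl fun e _ => ray_add_one x y e

lemma sum_cut_eq {E : Finset Bond} {a u : Site} {i : Fin 4} (hE : bond u i ∉ E)
    (hp : par E = pt a + pt (nb u i)) :
    ∑ e ∈ insert (bond u i) E, cut u i e =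
      ∑ e ∈ E, cut (nb u i) (op i) e + twist a u i := by
  have two : ∀ z : ZMod 2, z + z = 0 := by decide
  have hself : cut u i (bond u i) = 0 := by
    have hr : ray u (bond u i) = 0 := by
      fin_cases i <;> simp [ray, bond]
    rw [cut, hr, zero_add]
    refine Finset.sum_eq_zero fun j _ => if_neg fun h => ?_
    exact h.1.ne (bond_injective u h.2.symm)
  rw [Finset.sum_insert hE, hself, zero_add, sum_cut, sum_cut]
  have hpn := congrFun hp (nb u i)
  have hpu := congrFun hp u
  have hne : u ≠ nb u i := by
    obtain ⟨x, y⟩ := u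
    fin_cases i <;> simp [nb] <;> omega
  rw [Pi.add_apply, pt_self] at hpn
  rw [Pi.add_apply, pt_of_ne hne, add_zero] at hpu
  have hE0 : ind E (bond u i) = 0 := by simp [ind, hE]
  have hrow : ∀ y' x', (∀ z < x', (z, y') ≠ nb u i) →
      ∑ e ∈ E, ray (x', y') e + ∑ e ∈ E, ray (x', y' + 1) e + ind E ((x' - 1, y'), false) =
        if a.2 = y' ∧ a.1 < x' then 1 else 0 := by
    intro y' x' h
    refine ray_add_ray fun z hz => ?_
    rw [hp, Pi.add_apply, pt_of_ne (h z hz), add_zero, pt, Pi.single_apply]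
    simp only [Prod.ext_iff]
    exact if_congr ⟨fun h => ⟨h.2.symm, h.1⟩, fun h => ⟨h.2, h.1.symm⟩⟩ rfl rfl
  obtain ⟨x, y⟩ := u
  fin_cases i
  · have h := hrow (y - 1) x (fun z hz => by simp [nb]; omega)
    simp [par, nb, bond, op, twist, Fin.sum_univ_four, Fin.lt_def] at *
    rw [hE0] at hpn
    grind
  · have h := sum_ray_add_one E x y
    simp [par, nb, bond, op, twist, Fin.sum_univ_four, Fin.lt_def] at *
    rw [hE0] at hpn
    grind
  · have h := hrow y x (fun z hz => by simp [nb])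
    simp [par, nb, bond, op, twist, Fin.sum_univ_four, Fin.lt_def] at *
    rw [hE0] at hpu
    grind
  · have h := sum_ray_add_one E (x - 1) y
    simp [par, nb, bond, op, twist, Fin.sum_univ_four, Fin.lt_def] at *
    rw [hE0] at hpu
    grind

lemma obsIn_eq (G : Finset Bond) (w : Bond → ℝ) (a u : Site) (i : Fin 4) :
    obsIn G w a u i = if bond u i ∈ G then
      sg (twist a u i) * w (bond u i) * obs G w a (nb u i) (op i) else 0 := by
  have hsing : ∀ A : Site → ZMod 2, A + pt u = A + pt (nb u i) + (pt u + pt (nb u i)) := by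
    intro A
    rw [add_add_add_comm, add_comm (pt (nb u i)), pt_add_pt, add_zero]
  by_cases hG : bond u i ∈ G
  · rw [if_pos hG]
    unfold obsIn obs
    rw [Finset.mul_sum, ← Finset.sum_filter, bond_nb]
    have : ∀ E : Finset Bond, sg (twist a u i) * w (bond u i) * (if bond u i ∈ E then 0 else
        (∏ e ∈ E, w e) * sg (∑ e ∈ E, cut (nb u i) (op i) e)) = if bond u i ∉ E then
        sg (twist a u i) * w (bond u i) * ((∏ e ∈ E, w e) *
          sg (∑ e ∈ E, cut (nb u i) (op i) e)) else 0 := by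
      intro E; split_ifs <;> simp_all
    simp only [this]
    rw [← Finset.sum_filter]
    refine Finset.sum_bij' (fun E _ => E.erase (bond u i)) (fun E _ => insert (bond u i) E)
      ?_ ?_ ?_ ?_ ?_
    · intro E hE
      rw [Finset.mem_filter, mem_conf] at hE
      rw [Finset.mem_filter, mem_conf]
      refine ⟨⟨(Finset.erase_subset _ _).trans hE.1.1, ?_⟩, Finset.notMem_erase _ _⟩
      have h := par_insert (Finset.notMem_erase (bond u i) E)
      rw [Finset.insert_erase hE.2, hE.1.2, hsing] at h
      exact (add_right_cancel h).symm
    · intro E hE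
      rw [Finset.mem_filter, mem_conf] at hE
      rw [Finset.mem_filter, mem_conf]
      refine ⟨⟨Finset.insert_subset hG hE.1.1, ?_⟩, Finset.mem_insert_self _ _⟩
      rw [par_insert hE.2, hE.1.2, hsing]; rfl
    · intro E hE
      exact Finset.insert_erase (Finset.mem_filter.1 hE).2
    · intro E hE
      exact Finset.erase_insert (Finset.mem_filter.1 hE).2
    · intro E hE
      rw [Finset.mem_filter, mem_conf] at hE
      have hn := Finset.notMem_erase (bond u i) E
      have h := par_insert hn
      rw [Finset.insert_erase hE.2, hE.1.2, hsing] at h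
      have hs := sum_cut_eq hn (add_right_cancel h).symm
      rw [Finset.insert_erase hE.2] at hs
      rw [hs, sg_add, ← Finset.mul_prod_erase E w hE.2]
      ring
  · rw [if_neg hG]
    refine Finset.sum_eq_zero fun E hE => if_neg fun h => hG ((mem_conf.1 hE).1 h)

/-- The vertices covered by `G`, together with `a`. -/
noncomputable def cover (G : Finset Bond) (a : Site) : Finset Site :=
  insert a (G.image (fun e => e.1) ∪ G.image (fun e => (e.1.1 + 1, e.1.2)) ∪
    G.image (fun e => (e.1.1, e.1.2 + 1)))

lemma mem_cover_of_bond_mem {G : Finset Bond} {a u : Site} {i : Fin 4} (h : bond u i ∈ G) :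
    u ∈ cover G a := by
  obtain ⟨x, y⟩ := u
  simp only [cover, Finset.mem_insert, Finset.mem_union, Finset.mem_image]
  fin_cases i
  · exact Or.inr (Or.inr ⟨_, h, by simp [bond]⟩)
  · exact Or.inr (Or.inl (Or.inl ⟨_, h, by simp [bond]⟩))
  · exact Or.inr (Or.inl (Or.inl ⟨_, h, by simp [bond]⟩))
  · exact Or.inr (Or.inl (Or.inr ⟨_, h, by simp [bond]⟩))

lemma obs_eq_zero {G : Finset Bond} {a u : Site} (hu : u ∉ cover G a) (w : Bond → ℝ)
    (j : Fin 4) : obs G w a u j = 0 := by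
  have hua : u ≠ a := by rintro rfl; exact hu (Finset.mem_insert_self _ _)
  refine Finset.sum_eq_zero fun E hE => ?_
  exfalso
  have hp := congrFun (mem_conf.1 hE).2 u
  rw [Pi.add_apply, pt_self, pt_of_ne hua, zero_add] at hp
  have : par E u = 0 := Finset.sum_eq_zero fun i _ =>
    if_neg fun h => hu (mem_cover_of_bond_mem ((mem_conf.1 hE).1 h))
  rw [this] at hp
  exact absurd hp (by decide)

/-- The `ℓ¹`-distance on the lattice. -/
def dist' (u v : Site) : ℕ := (u.1 - v.1).natAbs + (u.2 - v.2).natAbs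

lemma dist'_le_nb (a u : Site) (i : Fin 4) : dist' a u ≤ 1 + dist' a (nb u i) := by
  fin_cases i <;> simp [dist', nb] <;> omega

lemma pow_dist'_le {μ : ℝ} (hμ : 1 ≤ μ) (a u : Site) (i : Fin 4) :
    μ ^ dist' a u ≤ μ * μ ^ dist' a (nb u i) := by
  rw [← pow_succ']
  exact pow_le_pow_right₀ hμ (by have := dist'_le_nb a u i; omega)

lemma exists_rate {x : ℝ} (hx : 0 ≤ x) (h : (1 + √2) * x < 1) :
    ∃ μ > 1, (1 + √2) * (x * μ) < 1 := by
  set y := (1 + √2) * x with hy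
  have hy0 : 0 ≤ y := by positivity
  refine ⟨1 + (1 - y) / 2, by linarith, ?_⟩
  have : (1 + √2) * (x * (1 + (1 - y) / 2)) = y * (1 + (1 - y) / 2) := by rw [hy]; ring
  rw [this]; nlinarith

lemma prod_mul_sg (w : Bond → ℝ) (k : Bond → ZMod 2) (E : Finset Bond) :
    ∏ e ∈ E, w e * sg (k e) = (∏ e ∈ E, w e) * sg (∑ e ∈ E, k e) := by
  rw [Finset.prod_mul_distrib, sg_sum]

lemma obs_bound {x μ κ : ℝ} (hμ : 1 ≤ μ)
    (hK : ∀ (V : Finset Site) (f b r : Site → Fin 4 → ℝ) (s q : Site → ℝ),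
      (∀ u ∉ V, ∀ j, f u j = 0) →
      (∀ u j, f u j = ∑ i, turn j i * b u i + s u) →
      (∀ u i, |b u i| ≤ x * (|f (nb u i) (op i)| + r u i)) →
      (∀ u, 0 < q u) → (∀ u i, q u ≤ μ * q (nb u i)) →
      ∑ u ∈ V, ∑ j, (q u * f u j) ^ 2 ≤
        κ ^ 2 * ∑ u ∈ V, q u ^ 2 * (s u ^ 2 + ∑ i, r u i ^ 2))
    {w : Bond → ℝ} (hw : ∀ e, |w e| ≤ x) (G : Finset Bond) (a : Site) :
    ∑ u ∈ cover G a, ∑ j, (μ ^ dist' a u * obs G w a u j) ^ 2 ≤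
      (κ * part G (fun e => w e * sg (ray a e)) 0) ^ 2 := by
  have hx : 0 ≤ x := (abs_nonneg _).trans (hw ((0, 0), false))
  have := hK (cover G a) (obs G w a) (obsIn G w a) 0
    (fun u => if u = a then part G (fun e => w e * sg (ray a e)) 0 else 0)
    (fun u => μ ^ dist' a u) (fun u hu j => obs_eq_zero hu w j) (obs_eq G w a) ?_
    (fun u => by positivity) (pow_dist'_le hμ a)
  · refine this.trans (le_of_eq ?_)
    rw [Finset.sum_eq_single a]
    · simp [dist', mul_pow]
    · intro u _ hu; simp [hu]
    · intro ha; exact absurd (Finset.mem_insert_self _ _) ha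
  · intro u i
    rw [obsIn_eq]
    simp only [Pi.zero_apply, add_zero]
    split_ifs
    · rw [abs_mul, abs_mul, abs_sg, one_mul]
      gcongr
      exact hw _
    · rw [abs_zero]; positivity

lemma le_of_sum_sq_le {V : Finset Site} {g : Site → Fin 4 → ℝ} {C : ℝ} (hC : 0 ≤ C)
    (h : ∑ u ∈ V, ∑ j, g u j ^ 2 ≤ C ^ 2) (hV : ∀ u ∉ V, ∀ j, g u j = 0) (u : Site) (j : Fin 4) :
    |g u j| ≤ C := by
  by_cases hu : u ∈ V
  · refine abs_le_of_sq_le_sq (le_trans ?_ h) hC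
    calc g u j ^ 2 ≤ ∑ j, g u j ^ 2 :=
          Finset.single_le_sum (f := fun j => g u j ^ 2) (fun _ _ => sq_nonneg _)
            (Finset.mem_univ j)
      _ ≤ _ := Finset.single_le_sum (f := fun u => ∑ j, g u j ^ 2)
          (fun _ _ => Finset.sum_nonneg fun _ _ => sq_nonneg _) hu
  · rw [hV u hu j, abs_zero]; exact hC

lemma exists_sq_energy_bound {x μ : ℝ} (hx : 0 ≤ x) (hμ : 0 < μ) (h : (1 + √2) * (x * μ) < 1) :
    ∃ κ > 0, ∀ (V : Finset Site) (f b r : Site → Fin 4 → ℝ) (s q : Site → ℝ),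
      (∀ u ∉ V, ∀ j, f u j = 0) →
      (∀ u j, f u j = ∑ i, turn j i * b u i + s u) →
      (∀ u i, |b u i| ≤ x * (|f (nb u i) (op i)| + r u i)) →
      (∀ u, 0 < q u) → (∀ u i, q u ≤ μ * q (nb u i)) →
      ∑ u ∈ V, ∑ j, (q u * f u j) ^ 2 ≤
        κ ^ 2 * ∑ u ∈ V, q u ^ 2 * (s u ^ 2 + ∑ i, r u i ^ 2) := by
  obtain ⟨K, hK, h⟩ := exists_energy_bound hx hμ h
  exact ⟨√K, Real.sqrt_pos.2 hK, by rwa [Real.sq_sqrt hK.le]⟩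

/-- Exponential decay of the free two-point function when one of the points is on the boundary. -/
lemma exists_two_point_bound {x : ℝ} (hx : 0 ≤ x) (h : (1 + √2) * x < 1) :
    ∃ ν < 1, 0 < ν ∧ ∃ C, ∀ (G : Finset Bond) (t : Bond → ℝ) (a v : Site) (j : Fin 4),
      (∀ e, 0 ≤ t e ∧ t e ≤ x) → bond v j ∉ G →
      part G t (pt a + pt v) ≤ C * ν ^ dist' a v * part G t 0 := by
  obtain ⟨μ, hμ, hxμ⟩ := exists_rate hx h
  have hμ0 : 0 < μ := by linarith
  obtain ⟨κ, hκ, hK⟩ := exists_sq_energy_bound hx hμ0 hxμ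
  refine ⟨μ⁻¹, inv_lt_one_of_one_lt₀ hμ, by positivity, κ, fun G t a v j ht hj => ?_⟩
  set w : Bond → ℝ := fun e => t e * sg (cut v j e) with hw
  have hw' : ∀ e, |w e| ≤ x := fun e => by
    rw [hw]; simp only [abs_mul, abs_sg, mul_one, abs_of_nonneg (ht e).1, (ht e).2]
  set c := part G (fun e => w e * sg (ray a e)) 0 with hc
  have hcle : |c| ≤ part G t 0 := by
    refine (Finset.abs_sum_le_sum_abs _ _).trans (Finset.sum_le_sum fun E _ => ?_)
    rw [Finset.abs_prod]
    refine le_of_eq (Finset.prod_congr rfl fun e _ => ?_)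
    simp only [hw, abs_mul, abs_sg, mul_one, abs_of_nonneg (ht e).1]
  have hb := obs_bound hμ.le hK hw' G a
  rw [← sq_abs (κ * _)] at hb
  have hp := le_of_sum_sq_le (g := fun u j => μ ^ dist' a u * obs G w a u j) (abs_nonneg _) hb
    (fun u hu j => by rw [obs_eq_zero hu, mul_zero]) v j
  have hobs : obs G w a v j = part G t (pt a + pt v) := by
    refine Finset.sum_congr rfl fun E hE => ?_
    rw [if_neg fun h => hj ((mem_conf.1 hE).1 h), hw, prod_mul_sg, mul_assoc, sg_mul_self, mul_one]
  rw [hobs, ← hc, abs_mul, abs_mul, abs_of_pos hκ, abs_of_nonneg (by positivity : 0 ≤ μ ^ _)] at hp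
  have h1 : part G t (pt a + pt v) ≤ |part G t (pt a + pt v)| := le_abs_self _
  rw [inv_pow, mul_assoc, mul_comm (μ ^ _)⁻¹, ← div_eq_mul_inv, ← mul_div_assoc,
    le_div_iff₀ (by positivity)]
  calc _ ≤ μ ^ dist' a v * |part G t (pt a + pt v)| := by rw [mul_comm]; gcongr
    _ ≤ κ * |c| := hp
    _ ≤ _ := by gcongr

/-- The part of the partition function without sources coming from subsets which contain `e₀`. -/
noncomputable def partIn (G : Finset Bond) (w : Bond → ℝ) (e₀ : Bond) : ℝ :=
  ∑ E ∈ conf G 0, if e₀ ∈ E then ∏ e ∈ E, w e else 0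

/-- Changing the signs of edge weights far away from a vertical edge has an exponentially small
effect on the normalized weight of the configurations containing that edge. -/
lemma exists_energy_comparison {x : ℝ} (hx : 0 ≤ x) (h : (1 + √2) * x < 1) :
    ∃ ν < 1, 0 < ν ∧ ∃ C > 0, ∀ (G : Finset Bond) (w : Bond → ℝ) (τ : Bond → ZMod 2) (a : Site)
      (d : ℕ), (∀ e, |w e| ≤ x) → (∀ u i, τ (bond u i) ≠ 0 → d ≤ dist' a u) →
      |part G w 0 * partIn G (fun e => w e * sg (τ e)) (bond a 0) -
        part G (fun e => w e * sg (τ e)) 0 * partIn G w (bond a 0)| ≤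
      |w (bond a 0)| * (C * ν ^ d * (|part G w 0| * |part G (fun e => w e * sg (τ e)) 0|)) := by
  obtain ⟨μ, hμ, hxμ⟩ := exists_rate hx h
  have hμ0 : 0 < μ := by linarith
  obtain ⟨κ, hκ, hK⟩ := exists_sq_energy_bound hx hμ0 hxμ
  refine ⟨μ⁻¹, inv_lt_one_of_one_lt₀ hμ, by positivity, 2 * κ ^ 2 + 2 * κ, by positivity,
    fun G w τ a d hw hd => ?_⟩
  set Z₀ := part G w 0 with hZ₀
  set Z₁ := part G (fun e => w e * sg (τ e)) 0 with hZ₁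
  set w₀ : Bond → ℝ := fun e => w e * sg (ray a e) with hw₀
  set w₁ : Bond → ℝ := fun e => w e * sg (τ e) * sg (ray a e) with hw₁
  have hw₁x : ∀ e, |w₁ e| ≤ x := fun e => by
    simp only [hw₁, abs_mul, abs_sg, mul_one]; exact hw e
  have hc₀ : part G (fun e => w₀ e * sg (ray a e)) 0 = Z₀ := by
    simp only [hw₀, mul_assoc, sg_mul_self, mul_one]; rfl
  have hc₁ : part G (fun e => w₁ e * sg (ray a e)) 0 = Z₁ := by
    simp only [hw₁, mul_assoc, sg_mul_self, mul_one]; rfl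
  have hin : ∀ w' : Bond → ℝ, obsIn G (fun e => w' e * sg (ray a e)) a a 0 =
      partIn G w' (bond a 0) := by
    intro w'
    unfold obsIn partIn
    rw [pt_add_pt]
    refine Finset.sum_congr rfl fun E _ => ?_
    rw [prod_mul_sg, sum_cut]
    simp [mul_assoc, sg_mul_self]
  set V := cover G a
  set f := fun u j => Z₀ * obs G w₁ a u j - Z₁ * obs G w₀ a u j with hf
  set b := fun u i => Z₀ * obsIn G w₁ a u i - Z₁ * obsIn G w₀ a u i with hb
  set r : Site → Fin 4 → ℝ := fun u i => if τ (bond u i) = 0 then 0 else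
    2 * |Z₀| * |obs G w₁ a (nb u i) (op i)| with hr
  have hr0 : ∀ u i, 0 ≤ r u i := fun u i => by simp only [hr]; split_ifs <;> positivity
  have hfV : ∀ u ∉ V, ∀ j, f u j = 0 := fun u hu j => by
    simp only [hf, obs_eq_zero hu]; ring
  have hfb : ∀ u j, f u j = ∑ i, turn j i * b u i + (0 : Site → ℝ) u := by
    intro u j
    simp only [hf, hb, obs_eq, hc₀, hc₁, mul_sub, Finset.sum_sub_distrib, mul_add, Finset.mul_sum,
      Pi.zero_apply]
    have : ∀ A B C D E F : ℝ, A = C → B = D → E = F → A + E - (B + F) = C - D + 0 := by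
      intros; subst_vars; ring
    apply this
    · exact Finset.sum_congr rfl fun i _ => by ring
    · exact Finset.sum_congr rfl fun i _ => by ring
    · split_ifs <;> ring
  have hbr : ∀ u i, |b u i| ≤ |w (bond u i)| * (|f (nb u i) (op i)| + r u i) := by
    intro u i
    simp only [hb, obsIn_eq]
    split_ifs with hG
    · rcases zmod_two_cases (τ (bond u i)) with h0 | h1
      · have : Z₀ * (sg (twist a u i) * w₁ (bond u i) * obs G w₁ a (nb u i) (op i)) -
            Z₁ * (sg (twist a u i) * w₀ (bond u i) * obs G w₀ a (nb u i) (op i)) =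
            sg (twist a u i) * sg (ray a (bond u i)) * (w (bond u i) * f (nb u i) (op i)) := by
          simp only [hw₁, hw₀, hf, h0, sg_zero]; ring
        rw [this, abs_mul, abs_mul, abs_sg, abs_sg, one_mul, one_mul, abs_mul]
        gcongr
        exact le_add_of_nonneg_right (hr0 _ _)
      · have : Z₀ * (sg (twist a u i) * w₁ (bond u i) * obs G w₁ a (nb u i) (op i)) -
            Z₁ * (sg (twist a u i) * w₀ (bond u i) * obs G w₀ a (nb u i) (op i)) =
            sg (twist a u i) * sg (ray a (bond u i)) * (w (bond u i) * (f (nb u i) (op i) -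
              2 * Z₀ * obs G w₁ a (nb u i) (op i))) := by
          simp only [hw₁, hw₀, hf, h1, sg_one]; ring
        rw [this, abs_mul, abs_mul, abs_sg, abs_sg, one_mul, one_mul, abs_mul]
        gcongr
        refine (abs_sub _ _).trans ?_
        simp only [hr, h1, one_ne_zero, if_false, abs_mul]
        simp
    · simp only [mul_zero, sub_zero, abs_zero]
      have := hr0 u i
      positivity
  have hobs₁ := obs_bound hμ.le hK hw₁x G a
  rw [hc₁] at hobs₁
  set D := (μ⁻¹) ^ d with hD
  have hD0 : 0 < D := by positivity
  have hDμ : ∀ u, d ≤ dist' a u → 1 ≤ D * μ ^ dist' a u := by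
    intro u hu
    rw [hD, inv_pow, inv_mul_eq_div, one_le_div (by positivity)]
    exact pow_le_pow_right₀ hμ.le hu
  have hrsum : ∑ u ∈ V, ∑ i, r u i ^ 2 ≤ (2 * κ * D * (|Z₀| * |Z₁|)) ^ 2 := by
    have hpt : ∀ u i, r u i ^ 2 ≤
        (2 * |Z₀| * D) ^ 2 * (μ ^ dist' a (nb u i) * obs G w₁ a (nb u i) (op i)) ^ 2 := by
      intro u i
      simp only [hr]
      split_ifs with h0
      · rw [zero_pow two_ne_zero]; positivity
      · have h1 := hDμ (nb u i) (hd _ (op i) (by rwa [bond_nb]))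
        rw [← mul_pow]
        refine pow_le_pow_left₀ (by positivity) ?_ 2 |>.trans (le_of_eq (sq_abs _))
        rw [abs_mul, abs_mul, abs_mul, abs_mul, abs_abs, abs_of_pos hD0,
          abs_of_pos (by positivity : 0 < μ ^ dist' a (nb u i)), abs_two]
        calc 2 * |Z₀| * |obs G w₁ a (nb u i) (op i)| =
            2 * |Z₀| * (1 * |obs G w₁ a (nb u i) (op i)|) := by ring
          _ ≤ 2 * |Z₀| * ((D * μ ^ dist' a (nb u i)) * |obs G w₁ a (nb u i) (op i)|) := by gcongr
          _ = _ := by ring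
    calc _ ≤ ∑ u ∈ V, ∑ i,
          (2 * |Z₀| * D) ^ 2 * (μ ^ dist' a (nb u i) * obs G w₁ a (nb u i) (op i)) ^ 2 :=
          Finset.sum_le_sum fun u _ => Finset.sum_le_sum fun i _ => hpt u i
      _ = (2 * |Z₀| * D) ^ 2 * ∑ u ∈ V, ∑ i,
          (μ ^ dist' a (nb u i) * obs G w₁ a (nb u i) (op i)) ^ 2 := by
          simp only [Finset.mul_sum]
      _ ≤ (2 * |Z₀| * D) ^ 2 * (κ * Z₁) ^ 2 := by
          gcongr
          refine le_trans (sum_nb_le (g := fun u j => (μ ^ dist' a u * obs G w₁ a u j) ^ 2)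
            (fun _ _ => sq_nonneg _) fun u hu j => ?_) hobs₁
          rw [obs_eq_zero hu]; ring
      _ = _ := by simp only [mul_pow, sq_abs]; ring
  have hfsum : ∑ u ∈ V, ∑ j, f u j ^ 2 ≤ (2 * κ ^ 2 * D * (|Z₀| * |Z₁|)) ^ 2 := by
    have := hK V f b r 0 (fun _ => 1) hfV hfb (fun u i => (hbr u i).trans ?_)
      (fun _ => one_pos) (fun _ _ => by linarith)
    · simp only [one_mul, Pi.zero_apply, one_pow, zero_pow two_ne_zero, zero_add] at this
      refine this.trans ?_
      calc _ ≤ κ ^ 2 * (2 * κ * D * (|Z₀| * |Z₁|)) ^ 2 := by gcongr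
        _ = _ := by ring
    · have := hr0 u i
      gcongr
      exact hw _
  have h1 := le_of_sum_sq_le (by positivity) hfsum hfV (nb a 0) (op 0)
  have h2 : r a 0 ≤ 2 * κ * D * (|Z₀| * |Z₁|) := by
    refine le_of_abs_le (abs_le_of_sq_le_sq (le_trans ?_ hrsum) (by positivity))
    calc r a 0 ^ 2 ≤ ∑ i, r a i ^ 2 :=
          Finset.single_le_sum (f := fun i => r a i ^ 2) (fun _ _ => sq_nonneg _)
            (Finset.mem_univ 0)
      _ ≤ _ := Finset.single_le_sum (f := fun u => ∑ j, r u j ^ 2)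
          (fun _ _ => Finset.sum_nonneg fun _ _ => sq_nonneg _) (Finset.mem_insert_self _ _)
  have h3 := hbr a 0
  simp only [hb, hw₀, hw₁, hin] at h3
  refine h3.trans ?_
  gcongr
  linarith

/-- The box `{-N,…,N}²`. -/
noncomputable def box (N : ℕ) : Finset Site := Finset.Icc (-(N : ℤ)) N ×ˢ Finset.Icc (-(N : ℤ)) N

lemma mem_box {N : ℕ} {u : Site} :
    u ∈ box N ↔ (-(N : ℤ) ≤ u.1 ∧ u.1 ≤ N) ∧ -(N : ℤ) ≤ u.2 ∧ u.2 ≤ N := by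
  simp [box]

/-- The second endpoint of an edge. -/
def snd (e : Bond) : Site := if e.2 = true then (e.1.1, e.1.2 + 1) else (e.1.1 + 1, e.1.2)

/-- The edges with an endpoint in the box. -/
noncomputable def touching (N : ℕ) : Finset Bond :=
  ((Finset.Icc (-(N : ℤ) - 1) N ×ˢ Finset.Icc (-(N : ℤ) - 1) N) ×ˢ Finset.univ).filter fun e =>
    e.1 ∈ box N ∨ snd e ∈ box N

lemma mem_touching {N : ℕ} {e : Bond} : e ∈ touching N ↔ e.1 ∈ box N ∨ snd e ∈ box N := by
  obtain ⟨⟨x, y⟩, b⟩ := e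
  simp only [touching, Finset.mem_filter, and_iff_right_iff_imp, mem_box, Finset.mem_product,
    Finset.mem_Icc, Finset.mem_univ, and_true, snd]
  cases b <;> simp <;> omega

/-- The spins with minus set `S`. -/
noncomputable def pm (S : Finset Site) (u : Site) : ℝ := if u ∈ S then -1 else 1

/-- Identification of the two models of the square lattice. -/
def toSite : (Fin 2 → ℤ) ≃ Site := finTwoArrowEquiv ℤ

lemma mem_cube_iff {N : ℕ} {u : Fin 2 → ℤ} : u ∈ cube 2 N ↔ toSite u ∈ box N := by
  simp [cube, mem_box, toSite, Fin.forall_fin_two]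

lemma dist1_eq_one_iff (u v : Fin 2 → ℤ) :
    dist1 u v = 1 ↔ ∃ i, toSite v = nb (toSite u) i := by
  simp only [dist1, Fin.sum_univ_two, toSite, finTwoArrowEquiv_apply, Fin.exists_fin_succ, nb]
  simp
  grind

lemma nb_injective (u : Site) : Function.Injective (nb u) := by
  intro i j h
  obtain ⟨x, y⟩ := u
  fin_cases i <;> fin_cases j <;> simp [nb] at h ⊢ <;> omega

lemma nbrs_eq (u : Fin 2 → ℤ) :
    nbrs u = Finset.univ.image fun i => toSite.symm (nb (toSite u) i) := by
  ext v
  have : dist1 u v = 1 ↔ ∃ i, toSite.symm (nb (toSite u) i) = v := by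
    rw [dist1_eq_one_iff]
    exact exists_congr fun i => by rw [Equiv.symm_apply_eq, eq_comm]
  simp only [nbrs, Finset.mem_filter, this, Finset.mem_image, Finset.mem_univ, true_and,
    and_iff_right_iff_imp, Fintype.mem_piFinset, Finset.mem_Icc]
  rintro ⟨i, rfl⟩
  simp only [Fin.forall_fin_two, toSite]
  fin_cases i <;> simp [nb, finTwoArrowEquiv] <;> omega

lemma sum_nbrs_inter (N : ℕ) (u : Fin 2 → ℤ) (f : Site → ℝ) :
    ∑ v ∈ cube 2 N, (if dist1 u v = 1 then f (toSite v) else 0) =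
      ∑ i, if nb (toSite u) i ∈ box N then f (nb (toSite u) i) else 0 := by
  rw [← Finset.sum_filter, ← Finset.sum_filter]
  symm
  refine Finset.sum_bij (fun i _ => toSite.symm (nb (toSite u) i)) ?_ ?_ ?_ ?_
  · intro i hi
    simp only [Finset.mem_filter, mem_cube_iff, Equiv.apply_symm_apply, dist1_eq_one_iff]
    exact ⟨(Finset.mem_filter.1 hi).2, i, rfl⟩
  · intro i _ j _ h
    exact nb_injective _ (toSite.symm.injective h)
  · intro v hv
    obtain ⟨hv, h⟩ := Finset.mem_filter.1 hv
    obtain ⟨i, hi⟩ := (dist1_eq_one_iff _ _).1 h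
    refine ⟨i, ?_, by rw [← hi, Equiv.symm_apply_apply]⟩
    simpa [← hi] using mem_cube_iff.1 hv
  · intro i _
    simp

lemma bCount_eq (N : ℕ) (u : Fin 2 → ℤ) :
    (bCount 2 N u : ℝ) = ∑ i, if nb (toSite u) i ∈ box N then 0 else 1 := by
  rw [bCount, nbrs_eq, ← Finset.filter_notMem_eq_sdiff, Finset.filter_image,
    Finset.card_image_of_injective]
  · simp [mem_cube_iff, Finset.sum_ite]
  · exact toSite.symm.injective.comp (nb_injective _)


lemma sum_box_eq_sum_nb (N : ℕ) (g : Site → ℝ) {i : Fin 4} (hi : i = 1 ∨ i = 2) :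
    ∑ u ∈ box N, g u = ∑ u ∈ Finset.Icc (-(N : ℤ) - 1) N ×ˢ Finset.Icc (-(N : ℤ) - 1) N,
      if nb u i ∈ box N then g (nb u i) else 0 := by
  rw [← Finset.sum_filter]
  have hop : op (op i) = i := op_op i
  refine Finset.sum_bij' (fun u _ => nb u (op i)) (fun u _ => nb u i) (fun u hu => ?_)
    (fun u hu => (Finset.mem_filter.1 hu).2) (fun u _ => ?_) (fun u _ => nb_nb u i) (fun u _ => ?_)
  · have : nb (nb u (op i)) i = u := by have := nb_nb u (op i); rwa [hop] at this
    rw [Finset.mem_filter, this]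
    refine ⟨?_, hu⟩
    rw [mem_box] at hu
    rw [Finset.mem_product, Finset.mem_Icc, Finset.mem_Icc]
    rcases hi with rfl | rfl <;> simp [nb, op] <;> omega
  · have := nb_nb u (op i); rwa [hop] at this
  · have := nb_nb u (op i); rw [hop] at this; rw [this]

lemma sum_box_eq_sum_Icc (N : ℕ) (g : Site → ℝ) :
    ∑ u ∈ box N, g u = ∑ u ∈ Finset.Icc (-(N : ℤ) - 1) N ×ˢ Finset.Icc (-(N : ℤ) - 1) N,
      if u ∈ box N then g u else 0 := by
  rw [← Finset.sum_filter]
  congr 1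
  ext u
  simp only [Finset.mem_filter, mem_box, Finset.mem_product, Finset.mem_Icc]
  omega

lemma sum_box_eq_sum_touching (N : ℕ) (s : Site → ℝ) :
    ∑ u ∈ box N, ∑ i, (if nb u i ∈ box N then 1 / 2 else 1) * (s u * s (nb u i)) =
      ∑ e ∈ touching N, s e.1 * s (snd e) := by
  rw [touching, Finset.sum_filter, Finset.sum_product]
  simp only [Fin.sum_univ_four, Finset.sum_add_distrib]
  rw [sum_box_eq_sum_nb N _ (Or.inr rfl), sum_box_eq_sum_Icc N (fun u => _ * (s u * s (nb u 1))),
    sum_box_eq_sum_Icc N (fun u => _ * (s u * s (nb u 2))), sum_box_eq_sum_nb N _ (Or.inl rfl)]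
  simp only [← Finset.sum_add_distrib]
  refine Finset.sum_congr rfl fun u _ => ?_
  have h0 : nb (nb u 2) 0 = u := nb_nb u 2
  have h3 : nb (nb u 1) 3 = u := nb_nb u 1
  have h1 : snd (u, false) = nb u 1 := by simp [snd, nb]
  have h2 : snd (u, true) = nb u 2 := by simp [snd, nb]
  rw [h0, h3]
  simp only [Fintype.sum_bool, h1, h2]
  by_cases hu : u ∈ box N <;> by_cases hu1 : nb u 1 ∈ box N <;> by_cases hu2 : nb u 2 ∈ box N <;>
    simp [hu, hu1, hu2] <;> ring

/-- The minus set of a configuration. -/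
noncomputable def minus {N : ℕ} (σ : {x // x ∈ cube 2 N} → Bool) : Finset Site :=
  (Finset.univ.filter fun u => σ u = false).image fun u : {x // x ∈ cube 2 N} => toSite u

lemma mem_minus {N : ℕ} {σ : {x // x ∈ cube 2 N} → Bool} {u : {x // x ∈ cube 2 N}} :
    toSite u ∈ minus σ ↔ σ u = false := by
  simp [minus]

lemma minus_subset {N : ℕ} (σ : {x // x ∈ cube 2 N} → Bool) : minus σ ⊆ box N := by
  intro u hu
  simp only [minus, Finset.mem_image] at hu
  obtain ⟨v, _, rfl⟩ := hu
  exact mem_cube_iff.1 v.2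

lemma pm_minus {N : ℕ} (σ : {x // x ∈ cube 2 N} → Bool) (u : {x // x ∈ cube 2 N}) :
    pm (minus σ) (toSite u) = spin (σ u) := by
  simp only [pm, mem_minus, spin]
  cases σ u <;> simp

lemma pm_of_notMem {N : ℕ} {S : Finset Site} (hS : S ⊆ box N) {u : Site} (hu : u ∉ box N) :
    pm S u = 1 := if_neg fun h => hu (hS h)

lemma sum_minus (N : ℕ) (F : Finset Site → ℝ) :
    ∑ σ : {x // x ∈ cube 2 N} → Bool, F (minus σ) = ∑ S ∈ (box N).powerset, F S := by
  refine Finset.sum_bij' (fun σ _ => minus σ) (fun S _ u => decide (toSite u ∉ S))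
    (fun σ _ => Finset.mem_powerset.2 (minus_subset σ)) (fun _ _ => Finset.mem_univ _)
    (fun σ _ => ?_) (fun S hS => ?_) (fun _ _ => rfl)
  · ext u
    simp only [mem_minus]
    cases σ u <;> simp
  · ext u
    constructor
    · intro h
      obtain ⟨v, hv, rfl⟩ := Finset.mem_image.1 h
      simpa using hv
    · intro h
      have hu : toSite.symm u ∈ cube 2 N := by
        rw [mem_cube_iff, Equiv.apply_symm_apply]; exact Finset.mem_powerset.1 hS h
      refine Finset.mem_image.2 ⟨⟨toSite.symm u, hu⟩, ?_, by simp⟩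
      simpa using h

lemma sum_cube (N : ℕ) (g : Site → ℝ) : ∑ u ∈ cube 2 N, g (toSite u) = ∑ u ∈ box N, g u :=
  Finset.sum_bij' (fun u _ => toSite u) (fun u _ => toSite.symm u)
    (fun _ h => mem_cube_iff.1 h) (fun u h => by rwa [mem_cube_iff, Equiv.apply_symm_apply])
    (fun u _ => by simp) (fun u _ => by simp) (fun _ _ => rfl)

/-- The Boltzmann weight of the spins with minus set `S`. -/
noncomputable def weight (N : ℕ) (β : ℝ) (S : Finset Site) : ℝ :=
  Real.exp (β * ∑ e ∈ touching N, pm S e.1 * pm S (snd e))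

lemma plusWeight_eq (N : ℕ) (β : ℝ) (σ : {x // x ∈ cube 2 N} → Bool) :
    plusWeight 2 N β σ = weight N β (minus σ) := by
  set s := pm (minus σ) with hs
  have h1 : ∑ u ∈ (cube 2 N).attach, ∑ v ∈ (cube 2 N).attach,
      (if dist1 (u : Fin 2 → ℤ) v = 1 then spin (σ u) * spin (σ v) else 0) =
      ∑ u ∈ box N, ∑ i, if nb u i ∈ box N then s u * s (nb u i) else 0 := by
    rw [← sum_cube, ← Finset.sum_attach (cube 2 N)]
    refine Finset.sum_congr rfl fun u _ => ?_
    rw [← sum_nbrs_inter N u fun v => s (toSite u) * s v, ← Finset.sum_attach (cube 2 N)]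
    simp only [hs, pm_minus]
  have h2 : ∑ u ∈ (cube 2 N).attach, (bCount 2 N u : ℝ) * spin (σ u) =
      ∑ u ∈ box N, ∑ i, if nb u i ∈ box N then 0 else s u * s (nb u i) := by
    rw [← sum_cube, ← Finset.sum_attach (cube 2 N)]
    refine Finset.sum_congr rfl fun u _ => ?_
    rw [bCount_eq, Finset.sum_mul, ← pm_minus]
    refine Finset.sum_congr rfl fun i _ => ?_
    split_ifs with h
    · simp
    · rw [hs, pm_of_notMem (minus_subset σ) h, one_mul, mul_one]
  rw [plusWeight, weight, h1, h2, ← sum_box_eq_sum_touching, Finset.mul_sum,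
    ← Finset.sum_add_distrib]
  congr 2
  refine Finset.sum_congr rfl fun u _ => ?_
  rw [Finset.mul_sum, ← Finset.sum_add_distrib]
  refine Finset.sum_congr rfl fun i _ => ?_
  split_ifs <;> ring

lemma mag_eq (N : ℕ) (β : ℝ) :
    mag 2 N β = (∑ S ∈ (box N).powerset, weight N β S * pm S (0, 0)) /
      ∑ S ∈ (box N).powerset, weight N β S := by
  have h0 : toSite (fun _ => 0) = (0, 0) := by simp [toSite]
  rw [← sum_minus N fun S => weight N β S * pm S (0, 0), ← sum_minus N (weight N β), mag]
  refine congrArg₂ _ ?_ ?_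
  · refine Finset.sum_congr rfl fun σ _ => ?_
    rw [plusWeight_eq, ← pm_minus σ ⟨fun _ => 0, origin_mem_cube 2 N⟩]
    rw [h0]
  · exact Finset.sum_congr rfl fun σ _ => plusWeight_eq N β σ

lemma par_eq_sum (E : Finset Bond) (u : Site) :
    par E u = ∑ e ∈ E, (pt e.1 u + pt (snd e) u) := by
  induction E using Finset.induction_on with
  | empty => simp [par_empty]
  | insert e E he ih =>
    obtain ⟨v, i, rfl, hv, hn⟩ : ∃ v i, e = bond v i ∧ e.1 = v ∧ snd e = nb v i := by
      obtain ⟨v, b⟩ := e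
      cases b
      · exact ⟨v, 1, by simp [bond, snd, nb]⟩
      · exact ⟨v, 2, by simp [bond, snd, nb]⟩
    rw [Finset.sum_insert he, par_insert he, ← ih, hv, hn, add_comm]
    rfl

lemma pm_eq_sg (S : Finset Site) (u : Site) : pm S u = sg (∑ v ∈ S, pt u v) := by
  simp only [pm, pt, Pi.single_apply, Finset.sum_ite_eq']
  split_ifs <;> simp [sg]

lemma prod_pm (S : Finset Site) (E : Finset Bond) :
    ∏ e ∈ E, pm S e.1 * pm S (snd e) = sg (∑ u ∈ S, par E u) := by
  simp only [par_eq_sum, pm_eq_sg, ← sg_add, ← Finset.sum_add_distrib]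
  rw [Finset.sum_comm, sg_sum]

lemma sum_powerset_sg (V : Finset Site) (A : Site → ZMod 2) :
    ∑ S ∈ V.powerset, sg (∑ u ∈ S, A u) = if ∀ u ∈ V, A u = 0 then 2 ^ V.card else 0 := by
  simp only [sg_sum]
  rw [← Finset.prod_one_add]
  split_ifs with h
  · rw [Finset.prod_congr rfl fun u hu => by rw [h u hu, sg_zero]]
    norm_num
  · push Not at h
    obtain ⟨u, hu, hA⟩ := h
    refine Finset.prod_eq_zero hu ?_
    rw [(zmod_two_cases (A u)).resolve_left hA, sg_one]
    norm_num

lemma pm_cases (S : Finset Site) (u : Site) : pm S u = 1 ∨ pm S u = -1 := by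
  unfold pm; split_ifs <;> simp

lemma exp_mul_pm (β : ℝ) (S : Finset Site) (u v : Site) :
    Real.exp (β * (pm S u * pm S v)) = Real.cosh β * (1 + Real.tanh β * (pm S u * pm S v)) := by
  have h : Real.cosh β ≠ 0 := (Real.cosh_pos β).ne'
  rw [Real.tanh_eq_sinh_div_cosh, mul_add, mul_one, ← mul_assoc (Real.cosh β),
    mul_div_cancel₀ _ h]
  rcases pm_cases S u with h1 | h1 <;> rcases pm_cases S v with h2 | h2 <;> rw [h1, h2] <;>
    simp [Real.cosh_add_sinh, ← sub_eq_add_neg, Real.cosh_sub_sinh]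

/-- The subsets of `G` which have sources `A` inside `V`. -/
noncomputable def confOn (G : Finset Bond) (V : Finset Site) (A : Site → ZMod 2) :
    Finset (Finset Bond) :=
  G.powerset.filter fun E => ∀ u ∈ V, par E u = A u

/-- The high-temperature expansion. -/
lemma sum_weight_mul_sg (N : ℕ) (β : ℝ) (A : Site → ZMod 2) :
    ∑ S ∈ (box N).powerset, weight N β S * sg (∑ u ∈ S, A u) =
      Real.cosh β ^ (touching N).card * 2 ^ (box N).card *
        ∑ E ∈ confOn (touching N) (box N) A, Real.tanh β ^ E.card := by
  have h2 : ∀ a b : ZMod 2, a + b = 0 ↔ a = b := by decide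
  have h1 : ∀ S, weight N β S * sg (∑ u ∈ S, A u) = Real.cosh β ^ (touching N).card *
      ∑ E ∈ (touching N).powerset, Real.tanh β ^ E.card * sg (∑ u ∈ S, (par E u + A u)) := by
    intro S
    rw [weight, Finset.mul_sum, Real.exp_sum]
    simp only [exp_mul_pm]
    rw [Finset.prod_mul_distrib, Finset.prod_const, Finset.prod_one_add, mul_assoc, Finset.sum_mul]
    congr 1
    refine Finset.sum_congr rfl fun E _ => ?_
    rw [Finset.prod_mul_distrib, prod_pm, Finset.prod_const, Finset.sum_add_distrib, sg_add]
    ring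
  simp only [h1]
  rw [← Finset.mul_sum, Finset.sum_comm, mul_assoc, confOn, Finset.sum_filter]
  congr 1
  rw [Finset.mul_sum]
  refine Finset.sum_congr rfl fun E _ => ?_
  rw [← Finset.mul_sum, sum_powerset_sg]
  simp only [h2]
  split_ifs <;> ring

lemma exists_path (n : ℕ) : ∀ (D : Finset Bond), D.card = n → ∀ a, par D a = 1 →
    ∃ v ≠ a, par D v = 1 ∧ ∃ p ⊆ D, par p = pt a + pt v := by
  induction n with
  | zero =>
    intro D hD a ha
    rw [Finset.card_eq_zero.1 hD, par_empty] at ha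
    exact absurd ha (by simp)
  | succ n ih =>
    intro D hD a ha
    obtain ⟨i, hi⟩ : ∃ i, bond a i ∈ D := by
      by_contra! h
      have : par D a = 0 := Finset.sum_eq_zero fun i _ => if_neg (h i)
      rw [this] at ha
      exact absurd ha (by decide)
    have hn := Finset.notMem_erase (bond a i) D
    have hp := par_insert hn
    rw [Finset.insert_erase hi] at hp
    have hab : a ≠ nb a i := by
      obtain ⟨x, y⟩ := a
      fin_cases i <;> simp [nb] <;> omega
    have hpa : par D a = par (D.erase (bond a i)) a + 1 := by
      rw [hp]; simp [hab]
    have hpb : par D (nb a i) = par (D.erase (bond a i)) (nb a i) + 1 := by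
      rw [hp]; simp [hab.symm]
    rcases zmod_two_cases (par D (nb a i)) with h0 | h1
    · obtain ⟨v, hv, hvp, p, hpD, hpp⟩ := ih (D.erase (bond a i))
        (by rw [Finset.card_erase_of_mem hi, hD]; rfl) (nb a i) (by
          rw [h0] at hpb
          rcases zmod_two_cases (par (D.erase (bond a i)) (nb a i)) with h | h
          · rw [h] at hpb; exact absurd hpb (by decide)
          · exact h)
      have hva : v ≠ a := by
        rintro rfl
        rw [ha, hvp] at hpa
        exact absurd hpa (by decide)
      refine ⟨v, hva, ?_, insert (bond a i) p,
        Finset.insert_subset hi (hpD.trans (Finset.erase_subset _ _)), ?_⟩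
      · rw [hp]; simp [hva, hv, hvp]
      · rw [par_insert fun h => hn (hpD h), hpp]
        change pt (nb a i) + pt v + (pt a + pt (nb a i)) = pt a + pt v
        rw [add_comm (pt (nb a i)) (pt v), add_comm (pt a), add_assoc, ← add_assoc (pt (nb a i)),
          pt_add_pt, zero_add, add_comm]
    · exact ⟨nb a i, hab.symm, h1, {bond a i}, by simpa using hi, par_singleton a i⟩

lemma card_symmDiff_add_card_symmDiff {α : Type*} [DecidableEq α] {E₁ E₂ p : Finset α}
    (hp : p ⊆ symmDiff E₁ E₂) :
    (symmDiff E₁ p).card + (symmDiff E₂ p).card = E₁.card + E₂.card := by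
  have h : ∀ a ∈ p, (a ∈ E₁ ∧ a ∉ E₂) ∨ a ∈ E₂ ∧ a ∉ E₁ := fun a ha =>
    Finset.mem_symmDiff.1 (hp ha)
  rw [← Finset.card_union_add_card_inter, ← Finset.card_union_add_card_inter E₁]
  congr 2 <;> ext a <;> have := h a <;>
    simp only [Finset.mem_union, Finset.mem_inter, Finset.mem_symmDiff] <;> tauto

/-- Moving a path of odd edges from one configuration to another one. -/
lemma switching {G : Finset Bond} {V W : Finset Site} {t : ℝ} (ht : 0 ≤ t) {a : Site}
    (ha : a ∈ V) (hW : ∀ v ∉ V, (∃ i, bond v i ∈ G) → v ∈ W) :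
    (∑ E ∈ confOn G V (pt a), t ^ E.card) * part G (fun _ => t) 0 ≤
      (∑ E ∈ confOn G V 0, t ^ E.card) *
        ∑ v ∈ W.filter (· ∉ V), part G (fun _ => t) (pt a + pt v) := by
  have key : ∀ D : Finset Bond, ∃ vp : Site × Finset Bond, D ∈ confOn G V (pt a) →
      vp.1 ∈ W.filter (· ∉ V) ∧ vp.2 ⊆ D ∧ par vp.2 = pt a + pt vp.1 := by
    intro D
    by_cases hD : D ∈ confOn G V (pt a)
    · obtain ⟨hDG, hDp⟩ := Finset.mem_filter.1 hD
      rw [Finset.mem_powerset] at hDG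
      obtain ⟨v, hva, hv, p, hp, hpp⟩ := exists_path _ D rfl a (by rw [hDp a ha, pt_self])
      have hvV : v ∉ V := fun h => by
        rw [hDp v h, pt_of_ne hva] at hv; exact absurd hv (by decide)
      refine ⟨(v, p), fun _ => ⟨Finset.mem_filter.2 ⟨hW v hvV ?_, hvV⟩, hp, hpp⟩⟩
      by_contra! h
      have : par D v = 0 := Finset.sum_eq_zero fun i _ => if_neg fun h' => h i (hDG h')
      rw [this] at hv; exact absurd hv (by decide)
    · exact ⟨(a, ∅), fun h => absurd h hD⟩
  choose vp hvp using key
  set φ : Finset Bond × Finset Bond → Finset Bond × (Σ _ : Site, Finset Bond) := fun q =>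
    (symmDiff q.1 (vp (symmDiff q.1 q.2)).2,
      ⟨(vp (symmDiff q.1 q.2)).1, symmDiff q.2 (vp (symmDiff q.1 q.2)).2⟩) with hφ
  have hD : ∀ q ∈ confOn G V (pt a) ×ˢ conf G 0, symmDiff q.1 q.2 ∈ confOn G V (pt a) := by
    intro q hq
    obtain ⟨h1, h2⟩ := Finset.mem_product.1 hq
    rw [confOn, Finset.mem_filter, Finset.mem_powerset] at h1 ⊢
    rw [mem_conf] at h2
    refine ⟨(Finset.symmDiff_subset_union).trans (Finset.union_subset h1.1 h2.1), fun u hu => ?_⟩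
    rw [par_symmDiff, h1.2 u hu, h2.2, Pi.zero_apply, add_zero]
  have hinj : Set.InjOn φ (confOn G V (pt a) ×ˢ conf G 0 : Finset _) := by
    rintro ⟨E₁, E₂⟩ _ ⟨F₁, F₂⟩ _ h
    simp only [hφ, Prod.mk.injEq, Sigma.mk.injEq, heq_eq_eq] at h
    obtain ⟨h1, -, h2⟩ := h
    have hd : ∀ A B p : Finset Bond, symmDiff (symmDiff A p) (symmDiff B p) = symmDiff A B := by
      intro A B p
      rw [symmDiff_symmDiff_symmDiff_comm, symmDiff_self, symmDiff_bot]
    have h3 : symmDiff E₁ E₂ = symmDiff F₁ F₂ := by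
      rw [← hd E₁ E₂ (vp (symmDiff E₁ E₂)).2, h1, h2, hd]
    rw [h3] at h1 h2
    exact Prod.ext (symmDiff_left_injective _ h1) (symmDiff_left_injective _ h2)
  have hpart : ∀ A, part G (fun _ => t) A = ∑ E ∈ conf G A, t ^ E.card := fun A => by
    simp only [part, Finset.prod_const]
  simp only [hpart]
  rw [Finset.sum_mul_sum, ← Finset.sum_product', Finset.sum_sigma', Finset.sum_mul_sum,
    ← Finset.sum_product']
  calc _ = ∑ q ∈ confOn G V (pt a) ×ˢ conf G 0, t ^ (φ q).1.card * t ^ (φ q).2.2.card := by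
        refine Finset.sum_congr rfl fun q hq => ?_
        rw [← pow_add, ← pow_add]
        exact congrArg (t ^ ·) (card_symmDiff_add_card_symmDiff (hvp _ (hD q hq)).2.1).symm
    _ = ∑ r ∈ (confOn G V (pt a) ×ˢ conf G 0).image φ, t ^ r.1.card * t ^ r.2.2.card :=
        (Finset.sum_image (f := fun r : Finset Bond × (Σ _ : Site, Finset Bond) =>
          t ^ r.1.card * t ^ r.2.2.card) hinj).symm
    _ ≤ _ := by
        refine Finset.sum_le_sum_of_subset_of_nonneg ?_ fun _ _ _ => by positivity
        intro r hr
        obtain ⟨q, hq, rfl⟩ := Finset.mem_image.1 hr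
        obtain ⟨hv, hp, hpp⟩ := hvp _ (hD q hq)
        have hpG := hp.trans (Finset.mem_powerset.1 (Finset.mem_filter.1 (hD q hq)).1)
        obtain ⟨h1, h2⟩ := Finset.mem_product.1 hq
        rw [confOn, Finset.mem_filter, Finset.mem_powerset] at h1
        rw [mem_conf] at h2
        rw [Finset.mem_product, Finset.mem_sigma, confOn, Finset.mem_filter, Finset.mem_powerset,
          mem_conf]
        refine ⟨⟨Finset.symmDiff_subset_union.trans (Finset.union_subset h1.1 hpG),
          fun u hu => ?_⟩, hv, Finset.symmDiff_subset_union.trans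
            (Finset.union_subset h2.1 hpG), ?_⟩
        · have huv : u ≠ (vp (symmDiff q.1 q.2)).1 := fun h =>
            (Finset.mem_filter.1 hv).2 (h ▸ hu)
          rw [par_symmDiff, h1.2 u hu, hpp, Pi.add_apply, pt_of_ne huv, add_zero, ← Pi.add_apply,
            pt_add_pt]
        · ext u
          rw [par_symmDiff, h2.2, Pi.zero_apply, zero_add, hpp]

lemma bond_mem_touching {N : ℕ} {v : Site} {i : Fin 4} :
    bond v i ∈ touching N ↔ v ∈ box N ∨ nb v i ∈ box N := by
  obtain ⟨x, y⟩ := v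
  rw [mem_touching]
  fin_cases i <;> simp [bond, nb, snd, or_comm]

lemma exists_bond_notMem_touching {N : ℕ} {v : Site} (hv : v ∉ box N) :
    ∃ i, bond v i ∉ touching N := by
  simp only [bond_mem_touching, hv, false_or]
  obtain ⟨x, y⟩ := v
  by_contra! h
  have h0 := h 0
  have h1 := h 1
  have h2 := h 2
  have h3 := h 3
  simp only [nb, mem_box, Matrix.cons_val] at h0 h1 h2 h3 hv
  omega

lemma mem_confOn {G : Finset Bond} {V : Finset Site} {A : Site → ZMod 2} {E : Finset Bond} :
    E ∈ confOn G V A ↔ E ⊆ G ∧ ∀ u ∈ V, par E u = A u := by simp [confOn]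

lemma part_pos {G : Finset Bond} {t : Bond → ℝ} (ht : ∀ e, 0 ≤ t e) : 0 < part G t 0 := by
  have h : ∏ e ∈ (∅ : Finset Bond), t e ≤ part G t 0 :=
    Finset.single_le_sum (f := fun E => ∏ e ∈ E, t e)
      (fun E _ => Finset.prod_nonneg fun e _ => ht e)
      (mem_conf.2 ⟨Finset.empty_subset G, par_empty⟩)
  rw [Finset.prod_empty] at h
  linarith

lemma mag_eq_highTemp (N : ℕ) (β : ℝ) :
    mag 2 N β = (∑ E ∈ confOn (touching N) (box N) (pt (0, 0)), Real.tanh β ^ E.card) /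
      ∑ E ∈ confOn (touching N) (box N) 0, Real.tanh β ^ E.card := by
  have h1 := sum_weight_mul_sg N β (pt (0, 0))
  have h2 := sum_weight_mul_sg N β 0
  simp only [← pm_eq_sg] at h1
  simp only [Pi.zero_apply, Finset.sum_const_zero, sg_zero, mul_one] at h2
  rw [mag_eq, h1, h2, mul_div_mul_left]
  have := Real.cosh_pos β
  positivity

lemma exists_mag_le {β : ℝ} (hβ : 0 ≤ β) (h : (1 + √2) * Real.tanh β < 1) :
    ∃ ν < 1, 0 < ν ∧ ∃ C, ∀ N : ℕ,
      0 ≤ mag 2 N β ∧ mag 2 N β ≤ (2 * (N : ℝ) + 3) ^ 2 * (C * ν ^ N) := by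
  have ht : 0 ≤ Real.tanh β := by
    rw [Real.tanh_eq_sinh_div_cosh]
    exact div_nonneg (Real.sinh_nonneg_iff.2 hβ) (Real.cosh_pos β).le
  obtain ⟨ν, hν1, hν0, C, hC⟩ := exists_two_point_bound ht h
  refine ⟨ν, hν1, hν0, |C|, fun N => ?_⟩
  rw [mag_eq_highTemp]
  refine ⟨by positivity, ?_⟩
  set t := Real.tanh β
  have hone : (∅ : Finset Bond) ∈ confOn (touching N) (box N) 0 :=
    mem_confOn.2 ⟨Finset.empty_subset _, fun u _ => by rw [par_empty]⟩
  have hD : 0 < ∑ E ∈ confOn (touching N) (box N) 0, t ^ E.card :=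
    lt_of_lt_of_le (by simp) (Finset.single_le_sum (f := fun E : Finset Bond => t ^ E.card)
      (fun _ _ => by positivity) hone)
  have hZ : 0 < part (touching N) (fun _ => t) 0 := part_pos fun _ => ht
  rw [div_le_iff₀ hD]
  set W := Finset.Icc (-((N : ℤ) + 1)) (N + 1) ×ˢ Finset.Icc (-((N : ℤ) + 1)) (N + 1) with hW
  have hsw := switching (G := touching N) (V := box N) (W := W) ht (a := (0, 0))
    (by simp [mem_box]) (by
      rintro ⟨x, y⟩ hv ⟨i, hi⟩
      rw [bond_mem_touching] at hi
      have hi := hi.resolve_left hv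
      simp only [hW, Finset.mem_product, Finset.mem_Icc]
      rw [mem_box] at hi
      fin_cases i <;> simp [nb] at hi <;> omega)
  have hterm : ∀ v ∈ W.filter (· ∉ box N), part (touching N) (fun _ => t) (pt (0, 0) + pt v) ≤
      |C| * ν ^ N * part (touching N) (fun _ => t) 0 := by
    intro v hv
    have hv := (Finset.mem_filter.1 hv).2
    obtain ⟨j, hj⟩ := exists_bond_notMem_touching hv
    refine (hC _ _ _ v j (fun _ => ⟨ht, le_rfl⟩) hj).trans ?_
    have hd : N ≤ dist' (0, 0) v := by
      rw [mem_box] at hv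
      simp only [dist']
      omega
    gcongr ?_ * _
    calc C * ν ^ dist' (0, 0) v ≤ |C| * ν ^ dist' (0, 0) v := by
          gcongr; exact le_abs_self C
      _ ≤ _ := by
          gcongr ?_ * ?_
          exact pow_le_pow_of_le_one hν0.le hν1.le hd
  have hsum := Finset.sum_le_card_nsmul _ _ _ hterm
  have hcard : ((W.filter (· ∉ box N)).card : ℝ) ≤ (2 * (N : ℝ) + 3) ^ 2 := by
    have h1 : W.card = (2 * N + 3) ^ 2 := by
      rw [hW, Finset.card_product, Int.card_Icc, sq]
      congr 1 <;> omega
    calc ((W.filter (· ∉ box N)).card : ℝ) ≤ (W.card : ℝ) := by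
          exact_mod_cast Finset.card_filter_le _ _
      _ = _ := by rw [h1]; push_cast; ring
  rw [nsmul_eq_mul] at hsum
  have hsum := hsum.trans (mul_le_mul_of_nonneg_right hcard
    (mul_nonneg (by positivity) hZ.le))
  refine le_of_mul_le_mul_right (hsw.trans ?_) hZ
  calc _ ≤ (∑ E ∈ confOn (touching N) (box N) 0, t ^ E.card) *
        ((2 * (N : ℝ) + 3) ^ 2 * (|C| * ν ^ N * part (touching N) (fun _ => t) 0)) := by
        exact mul_le_mul_of_nonneg_left hsum hD.le
    _ = _ := by ring

lemma tanh_lt {β : ℝ} (h : β < (1 / 2) * Real.log (1 + √2)) : (1 + √2) * Real.tanh β < 1 := by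
  have h2 : √2 ^ 2 = 2 := Real.sq_sqrt (by norm_num)
  have hp : 0 < √2 := by positivity
  have hy : Real.exp β ^ 2 < 1 + √2 := by
    rw [← Real.exp_nat_mul, ← Real.exp_log (by positivity : 0 < 1 + √2), Real.exp_lt_exp]
    push_cast
    linarith
  have hpos := Real.exp_pos β
  rw [Real.tanh_eq_sinh_div_cosh, ← mul_div_assoc, div_lt_one (Real.cosh_pos β), Real.sinh_eq,
    Real.cosh_eq, Real.exp_neg]
  have : (Real.exp β + (Real.exp β)⁻¹) / 2 - (1 + √2) * ((Real.exp β - (Real.exp β)⁻¹) / 2) =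
      √2 * (1 + √2 - Real.exp β ^ 2) / (2 * Real.exp β) := by
    field_simp
    linear_combination (-1 : ℝ) * h2
  have h3 : 0 < √2 * (1 + √2 - Real.exp β ^ 2) / (2 * Real.exp β) := by
    have : 0 < 1 + √2 - Real.exp β ^ 2 := by linarith
    positivity
  linarith

lemma mstar_eq_zero {β : ℝ} (hβ : 0 ≤ β) (h : β < (1 / 2) * Real.log (1 + √2)) :
    mstar 2 β = 0 := by
  obtain ⟨ν, hν1, hν0, C, hC⟩ := exists_mag_le hβ (tanh_lt h)
  have hlim : ∀ k : ℕ, Tendsto (fun N : ℕ => (N : ℝ) ^ k * ν ^ N) atTop (nhds 0) := fun k =>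
    tendsto_pow_const_mul_const_pow_of_abs_lt_one k (by rwa [abs_of_pos hν0])
  have h0 : Tendsto (fun N : ℕ => (2 * (N : ℝ) + 3) ^ 2 * (C * ν ^ N)) atTop (nhds 0) := by
    have := (((hlim 2).const_mul (4 * C)).add ((hlim 1).const_mul (12 * C))).add
      ((hlim 0).const_mul (9 * C))
    simp only [mul_zero, add_zero] at this
    refine this.congr fun N => ?_
    ring
  exact (squeeze_zero (fun N => (hC N).1) (fun N => (hC N).2) h0).limsup_eq

/-- The face to the left of a vertical edge, or below a horizontal one; the other face adjacent to
`e` has label `e.1`. -/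
def face (e : Bond) : Site := if e.2 = true then (e.1.1 - 1, e.1.2) else (e.1.1, e.1.2 - 1)

/-- The dual edge, where spins are attached to the faces of the dual lattice. -/
def dual (e : Bond) : Bond := (snd e, !e.2)

lemma face_dual (e : Bond) : face (dual e) = e.1 := by
  obtain ⟨⟨x, y⟩, b⟩ := e
  cases b <;> simp [face, dual, snd]

lemma dual_injective : Function.Injective dual := by
  rintro ⟨⟨x, y⟩, b⟩ ⟨⟨x', y'⟩, b'⟩ h
  cases b <;> cases b' <;> simp [dual, snd] at h ⊢ <;> omega

/-- The dual edges of the edges which touch the box. -/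
noncomputable def dualTouching (N : ℕ) : Finset Bond := (touching N).image dual

lemma mem_dualTouching {N : ℕ} {e : Bond} :
    e ∈ dualTouching N ↔ face e ∈ box N ∨ e.1 ∈ box N := by
  obtain ⟨e', rfl⟩ : ∃ e', dual e' = e := by
    obtain ⟨⟨x, y⟩, b⟩ := e
    cases b
    · exact ⟨((x, y - 1), true), by simp [dual, snd]⟩
    · exact ⟨((x - 1, y), false), by simp [dual, snd]⟩
  rw [dualTouching, dual_injective.mem_finset_image, mem_touching, face_dual]
  rfl

/-- The indicator of `u ∈ S` modulo two. -/
noncomputable def siteInd (S : Finset Site) (u : Site) : ZMod 2 := if u ∈ S then 1 else 0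

lemma pm_eq_sg_siteInd (S : Finset Site) (u : Site) : pm S u = sg (siteInd S u) := by
  unfold pm siteInd
  split_ifs <;> simp [sg]

/-- The edges of `dualTouching N` separating faces with different spins. -/
noncomputable def contour (N : ℕ) (S : Finset Site) : Finset Bond :=
  (dualTouching N).filter fun e => siteInd S (face e) + siteInd S e.1 = 1

lemma ind_contour {N : ℕ} {S : Finset Site} (hS : S ⊆ box N) (e : Bond) :
    ind (contour N S) e = siteInd S (face e) + siteInd S e.1 := by
  simp only [ind, contour, Finset.mem_filter]
  rcases zmod_two_cases (siteInd S (face e) + siteInd S e.1) with h | h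
  · simp [h]
  · suffices e ∈ dualTouching N by simp [h, this]
    rw [mem_dualTouching]
    by_contra! hn
    rw [siteInd, siteInd, if_neg fun h => hn.1 (hS h), if_neg fun h => hn.2 (hS h)] at h
    exact absurd h (by decide)

lemma contour_subset (N : ℕ) (S : Finset Site) : contour N S ⊆ dualTouching N :=
  Finset.filter_subset _ _

lemma par_contour {N : ℕ} {S : Finset Site} (hS : S ⊆ box N) : par (contour N S) = 0 := by
  ext ⟨x, y⟩
  have two : ∀ z : ZMod 2, z + z = 0 := by decide
  simp [par, ind_contour hS, Fin.sum_univ_four, bond, face]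
  linear_combination two (siteInd S (x - 1, y - 1)) + two (siteInd S (x, y - 1)) +
    two (siteInd S (x - 1, y)) + two (siteInd S (x, y))

/-- The number modulo two of edges of `E` to the left of the face `u`. -/
noncomputable def wind (E : Finset Bond) (u : Site) : ZMod 2 := ∑ e ∈ E, ray (u.1 + 1, u.2 + 1) e

lemma wind_add_of_vertical (E : Finset Bond) (x y : ℤ) :
    wind E (x - 1, y) + wind E (x, y) = ind E ((x, y), true) := by
  have two : ∀ z : ZMod 2, z + z = 0 := by decide
  have := sum_ray_add_one E x (y + 1)
  simp only [wind, sub_add_cancel]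
  rw [this, ← add_assoc, two, zero_add, add_sub_cancel_right]

lemma wind_add_of_horizontal {E : Finset Bond} (hE : par E = 0) (x y : ℤ) :
    wind E (x, y - 1) + wind E (x, y) = ind E ((x, y), false) := by
  have two : ∀ z : ZMod 2, z + z = 0 := by decide
  have := ray_add_ray (E := E) (y := y) (A := 0) (t := False) (x := x + 1) (fun x' _ => by
    rw [hE]; simp)
  simp only [wind, sub_add_cancel]
  simp only [false_and, if_false, add_sub_cancel_right] at this
  rw [← add_zero (∑ e ∈ E, ray (x + 1, y) e + _), ← two (ind E ((x, y), false)), ← add_assoc, this,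
    zero_add]

lemma wind_add {E : Finset Bond} (hE : par E = 0) (e : Bond) :
    wind E (face e) + wind E e.1 = ind E e := by
  obtain ⟨⟨x, y⟩, b⟩ := e
  cases b
  · simpa [face] using wind_add_of_horizontal hE x y
  · simpa [face] using wind_add_of_vertical E x y

lemma wind_eq_zero_of_lt {N : ℕ} {E : Finset Bond} (hG : E ⊆ dualTouching N) {u : Site}
    (hu : u.1 < -N ∨ u.2 < -N ∨ N < u.2) : wind E u = 0 := by
  refine Finset.sum_eq_zero fun e he => if_neg ?_
  rintro ⟨h1, h2, h3⟩
  have := mem_dualTouching.1 (hG he)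
  simp only [face, h1, if_true, mem_box] at this
  simp only at h2 h3
  omega

lemma wind_eq_zero {N : ℕ} {E : Finset Bond} (hE : par E = 0) (hG : E ⊆ dualTouching N) {u : Site}
    (hu : u ∉ box N) : wind E u = 0 := by
  obtain ⟨x, y⟩ := u
  by_cases h : x < -N ∨ y < -N ∨ N < y
  · exact wind_eq_zero_of_lt hG h
  have hx : (N : ℤ) < x := by
    rw [mem_box] at hu
    push Not at h
    by_contra! hx
    exact hu ⟨⟨h.1, hx⟩, h.2⟩
  have key : ∀ z : ℤ, -(N : ℤ) - 1 ≤ z → wind E (x, z) = 0 := by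
    intro z hz
    induction z, hz using Int.leInduction with
    | base => exact wind_eq_zero_of_lt hG (Or.inr (Or.inl (by simp)))
    | succ z _ ih =>
      have h1 := wind_add_of_horizontal hE x (z + 1)
      rw [add_sub_cancel_right, ih, zero_add] at h1
      rw [h1, ind, if_neg fun he => ?_]
      have := mem_dualTouching.1 (hG he)
      simp [face, mem_box] at this
      omega
  exact key y (by omega)

lemma siteInd_filter_wind {N : ℕ} {E : Finset Bond} (hE : par E = 0) (hG : E ⊆ dualTouching N)
    (u : Site) : siteInd ((box N).filter fun u => wind E u = 1) u = wind E u := by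
  simp only [siteInd, Finset.mem_filter]
  rcases zmod_two_cases (wind E u) with h | h
  · simp [h]
  · suffices u ∈ box N by simp [h, this]
    by_contra hu
    rw [wind_eq_zero hE hG hu] at h
    exact absurd h (by decide)

lemma wind_contour {N : ℕ} {S : Finset Site} (hS : S ⊆ box N) (u : Site) :
    wind (contour N S) u = siteInd S u := by
  obtain ⟨x, y⟩ := u
  have h0 : ∀ z : ℤ, z < -N → wind (contour N S) (z, y) = siteInd S (z, y) := by
    intro z hz
    rw [wind_eq_zero_of_lt (u := (z, y)) (contour_subset N S) (Or.inl hz),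
      siteInd, if_neg]
    intro h
    have := mem_box.1 (hS h)
    simp only at this
    omega
  by_cases hx : x < -N
  · exact h0 x hx
  have key : ∀ z : ℤ, -(N : ℤ) - 1 ≤ z → wind (contour N S) (z, y) = siteInd S (z, y) := by
    intro z hz
    induction z, hz using Int.leInduction with
    | base => exact h0 _ (by omega)
    | succ z _ ih =>
      have h1 := wind_add_of_vertical (contour N S) (z + 1) y
      rw [ind_contour hS, add_sub_cancel_right, ih] at h1
      simpa [face] using h1
  exact key x (by omega)

lemma exp_mul_pm_eq (β : ℝ) (S : Finset Site) (u v : Site) :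
    Real.exp (β * (pm S u * pm S v)) =
      Real.exp β * if siteInd S u + siteInd S v = 1 then Real.exp (-2 * β) else 1 := by
  have two : (1 + 1 : ZMod 2) = 0 := by decide
  unfold pm siteInd
  by_cases hu : u ∈ S <;> by_cases hv : v ∈ S <;> simp [hu, hv, two]
  all_goals rw [← Real.exp_add]; congr 1; ring

lemma weight_eq (N : ℕ) (β : ℝ) (S : Finset Site) :
    weight N β S = Real.exp β ^ (touching N).card *
      ∏ _e ∈ contour N S, Real.exp (-2 * β) := by
  rw [weight, Finset.mul_sum, Real.exp_sum]
  simp only [exp_mul_pm_eq]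
  rw [Finset.prod_mul_distrib, Finset.prod_const, contour, Finset.prod_filter, dualTouching,
    Finset.prod_image dual_injective.injOn]
  simp only [face_dual]
  rfl

lemma sum_weight_eq (N : ℕ) (β : ℝ) (F : ZMod 2 → ℝ) :
    ∑ S ∈ (box N).powerset, weight N β S * F (siteInd S (0, 0)) =
      Real.exp β ^ (touching N).card * ∑ E ∈ conf (dualTouching N) 0,
        (∏ _e ∈ E, Real.exp (-2 * β)) * F (∑ e ∈ E, ray (1, 1) e) := by
  rw [Finset.mul_sum]
  have hw : ∀ E, ∑ e ∈ E, ray (1, 1) e = wind E (0, 0) := fun E => by simp [wind]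
  refine Finset.sum_bij' (fun S _ => contour N S)
    (fun E _ => (box N).filter fun u => wind E u = 1) ?_ ?_ ?_ ?_ ?_
  · intro S hS
    exact mem_conf.2 ⟨contour_subset N S, par_contour (Finset.mem_powerset.1 hS)⟩
  · intro E _
    exact Finset.mem_powerset.2 (Finset.filter_subset _ _)
  · intro S hS
    have hS := Finset.mem_powerset.1 hS
    ext u
    simp only [wind_contour hS, Finset.mem_filter, siteInd]
    constructor
    · rintro ⟨_, h⟩
      by_contra hu
      simp [hu] at h
    · intro h
      exact ⟨hS h, if_pos h⟩
  · intro E hE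
    obtain ⟨hG, hE⟩ := mem_conf.1 hE
    ext e
    have h := ind_contour (N := N) (Finset.filter_subset (fun u => wind E u = 1) (box N)) e
    rw [siteInd_filter_wind hE hG, siteInd_filter_wind hE hG, wind_add hE] at h
    simp only [ind] at h
    split_ifs at h with h1 h2 h2 <;> simp_all
  · intro S hS
    rw [hw, wind_contour (Finset.mem_powerset.1 hS), weight_eq]
    ring

/-- The low-temperature expansion. -/
lemma mag_eq_lowTemp (N : ℕ) (β : ℝ) :
    mag 2 N β = part (dualTouching N) (fun e => Real.exp (-2 * β) * sg (ray (1, 1) e)) 0 /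
      part (dualTouching N) (fun _ => Real.exp (-2 * β)) 0 := by
  have h1 := sum_weight_eq N β sg
  have h2 := sum_weight_eq N β fun _ => 1
  simp only [mul_one] at h2
  simp only [← pm_eq_sg_siteInd] at h1
  rw [mag_eq, h1, h2, mul_div_mul_left _ _ (by positivity)]
  unfold part
  simp only [prod_mul_sg]

/-- A Grönwall-type lower bound. -/
lemma exp_neg_le_of_abs_deriv_le {h h' : ℝ → ℝ} {C : ℝ} (hc : ContinuousOn h (Set.Icc 0 1))
    (hd : ∀ t ∈ Set.Ioo (0 : ℝ) 1, HasDerivAt h (h' t) t)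
    (hb : ∀ t ∈ Set.Ioo (0 : ℝ) 1, |h' t| ≤ C * |h t|) (h0 : h 0 = 1) :
    Real.exp (-C) ≤ h 1 := by
  set g : ℝ → ℝ := fun t => h t ^ 2 * Real.exp (2 * C * t) with hg
  have hgd : ∀ t ∈ Set.Ioo (0 : ℝ) 1, HasDerivAt g
      (2 * h t * h' t * Real.exp (2 * C * t) + h t ^ 2 * (Real.exp (2 * C * t) * (2 * C))) t := by
    intro t ht
    have h1 := (hd t ht).pow 2
    have h2 : HasDerivAt (fun t => Real.exp (2 * C * t)) (Real.exp (2 * C * t) * (2 * C)) t := by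
      have := ((hasDerivAt_id t).const_mul (2 * C)).exp
      simpa using this
    exact (h1.mul h2).congr_deriv (by simp)
  have hmono : MonotoneOn g (Set.Icc 0 1) := by
    refine monotoneOn_of_deriv_nonneg (convex_Icc 0 1) ?_ ?_ ?_
    · exact (hc.pow 2).mul (by fun_prop)
    · rw [interior_Icc]
      exact fun t ht => (hgd t ht).differentiableAt.differentiableWithinAt
    · rw [interior_Icc]
      intro t ht
      rw [(hgd t ht).deriv]
      have h1 : -(h t * h' t) ≤ C * h t ^ 2 := by
        calc -(h t * h' t) ≤ |h t * h' t| := neg_le_abs _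
          _ = |h t| * |h' t| := abs_mul _ _
          _ ≤ |h t| * (C * |h t|) := by gcongr; exact hb t ht
          _ = C * h t ^ 2 := by rw [← sq_abs (h t)]; ring
      have h2 := Real.exp_pos (2 * C * t)
      nlinarith
  have hge : ∀ t ∈ Set.Icc (0 : ℝ) 1, 1 ≤ g t := by
    intro t ht
    have := hmono (Set.left_mem_Icc.2 zero_le_one) ht ht.1
    simpa [hg, h0] using this
  have hpos : 0 < h 1 := by
    by_contra! hn
    obtain ⟨t, ht, hz⟩ := intermediate_value_Icc' zero_le_one hc ⟨hn, h0 ▸ zero_le_one⟩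
    have := hge t ht
    simp only [hg, hz] at this
    norm_num at this
  have h1 := hge 1 (Set.right_mem_Icc.2 zero_le_one)
  simp only [hg, mul_one] at h1
  refine (pow_le_pow_iff_left₀ (Real.exp_pos _).le hpos.le two_ne_zero).1 ?_
  rw [← Real.exp_nat_mul, show ((2 : ℕ) : ℝ) * -C = -(2 * C) by push_cast; ring, Real.exp_neg]
  exact (inv_le_iff_one_le_mul₀ (Real.exp_pos _)).2 h1

/-- Edge weights which interpolate between the homogeneous ones and those without vertical edges. -/
noncomputable def interp (x t : ℝ) (e : Bond) : ℝ := if e.2 = true then t * x else x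

lemma prod_interp (x t : ℝ) (E : Finset Bond) :
    ∏ e ∈ E, interp x t e = x ^ E.card * t ^ (E.filter fun e => e.2 = true).card := by
  rw [← Finset.prod_const x, ← Finset.prod_const t, Finset.prod_filter, ← Finset.prod_mul_distrib]
  refine Finset.prod_congr rfl fun e _ => ?_
  unfold interp
  split_ifs <;> ring

lemma hasDerivAt_part_interp (G : Finset Bond) (τ : Bond → ZMod 2) (x : ℝ) {t : ℝ} (ht : t ≠ 0) :
    HasDerivAt (fun t => part G (fun e => interp x t e * sg (τ e)) 0)
      (t⁻¹ * ∑ e ∈ G.filter fun e => e.2 = true,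
        partIn G (fun e => interp x t e * sg (τ e)) e) t := by
  unfold part partIn
  rw [Finset.sum_comm, Finset.mul_sum]
  refine HasDerivAt.fun_sum fun E hE => ?_
  simp only [prod_mul_sg, prod_interp]
  have h1 : ∀ c : ℝ, ∑ e ∈ G.filter fun e => e.2 = true, (if e ∈ E then c else 0) =
      (E.filter fun e => e.2 = true).card * c := by
    intro c
    rw [← Finset.sum_filter, Finset.sum_const, nsmul_eq_mul]
    congr 3
    ext e
    have : e ∈ E → e ∈ G := fun h => (mem_conf.1 hE).1 h
    simp only [Finset.mem_filter]
    tauto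
  rw [h1]
  set k := (E.filter fun e => e.2 = true).card
  have h2 := ((hasDerivAt_pow k t).const_mul (x ^ E.card)).mul_const (sg (∑ e ∈ E, τ e))
  refine h2.congr_deriv ?_
  rcases Nat.eq_zero_or_pos k with hk | hk
  · simp [hk]
  · obtain ⟨m, hm⟩ := Nat.exists_eq_succ_of_ne_zero hk.ne'
    rw [hm]
    simp only [Nat.succ_eq_add_one, add_tsub_cancel_right]
    field_simp
    ring

lemma part_interp_zero (G : Finset Bond) (x : ℝ) :
    part G (fun e => interp x 0 e * sg (ray (1, 1) e)) 0 = part G (interp x 0) 0 := by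
  refine Finset.sum_congr rfl fun E _ => ?_
  rw [prod_mul_sg, prod_interp]
  by_cases h : ∃ e ∈ E, e.2 = true
  · obtain ⟨e, he, h⟩ := h
    rw [zero_pow, mul_zero, zero_mul]
    exact Finset.card_ne_zero_of_mem (Finset.mem_filter.2 ⟨he, h⟩)
  · have : ∑ e ∈ E, ray (1, 1) e = 0 := Finset.sum_eq_zero fun e he =>
      if_neg fun h' => h ⟨e, he, h'.1⟩
    rw [this, sg_zero, mul_one]

/-- The indicator of the vertical edges which cross the rightward ray from the face `(0, 0)`. -/
def rightRay (e : Bond) : ZMod 2 := if e.2 = true ∧ e.1.2 = 0 ∧ 1 ≤ e.1.1 then 1 else 0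

lemma sum_rightRay {N : ℕ} {E : Finset Bond} (hE : E ∈ conf (dualTouching N) 0) :
    ∑ e ∈ E, rightRay e = ∑ e ∈ E, ray (1, 1) e := by
  have two : ∀ y z : ZMod 2, y + z = 0 → y = z := by decide
  obtain ⟨hG, hE⟩ := mem_conf.1 hE
  refine two _ _ ?_
  rw [← Finset.sum_add_distrib, ← wind_eq_zero (u := ((N : ℤ) + 1, 0)) hE hG (by simp [mem_box])]
  refine Finset.sum_congr rfl fun e he => ?_
  have := mem_dualTouching.1 (hG he)
  obtain ⟨⟨a, b⟩, c⟩ := e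
  simp only [mem_box, face] at this
  simp only [rightRay, ray]
  split_ifs at this ⊢ <;> first | rfl | (simp_all; done) | (exfalso; simp_all; omega)

lemma part_rightRay (N : ℕ) (w : Bond → ℝ) :
    part (dualTouching N) (fun e => w e * sg (rightRay e)) 0 =
      part (dualTouching N) (fun e => w e * sg (ray (1, 1) e)) 0 :=
  Finset.sum_congr rfl fun E hE => by rw [prod_mul_sg, prod_mul_sg, sum_rightRay hE]

lemma partIn_rightRay (N : ℕ) (w : Bond → ℝ) (e₀ : Bond) :
    partIn (dualTouching N) (fun e => w e * sg (rightRay e)) e₀ =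
      partIn (dualTouching N) (fun e => w e * sg (ray (1, 1) e)) e₀ :=
  Finset.sum_congr rfl fun E hE => by rw [prod_mul_sg, prod_mul_sg, sum_rightRay hE]

lemma le_dist'_of_ray {a u : Site} {i : Fin 4} (ha : 1 ≤ a.1) (h : ray (1, 1) (bond u i) ≠ 0) :
    a.1.natAbs + a.2.natAbs - 1 ≤ dist' a u := by
  have h := not_not.1 fun h' => h (if_neg h')
  obtain ⟨x, y⟩ := u
  fin_cases i <;> simp [bond, dist'] at h ⊢ <;> omega

lemma le_dist'_of_rightRay {a u : Site} {i : Fin 4} (ha : a.1 < 1)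
    (h : rightRay (bond u i) ≠ 0) : a.1.natAbs + a.2.natAbs - 1 ≤ dist' a u := by
  have h := not_not.1 fun h' => h (if_neg h')
  obtain ⟨x, y⟩ := u
  fin_cases i <;> simp [bond, dist'] at h ⊢ <;> omega

lemma summable_pow_natAbs {ν : ℝ} (h0 : 0 < ν) (h1 : ν < 1) :
    Summable fun a : ℤ × ℤ => ν ^ a.1.natAbs * ν ^ a.2.natAbs := by
  have h : Summable fun k : ℤ => ν ^ k.natAbs := by
    rw [summable_int_iff_summable_nat_and_neg]
    simp only [Int.natAbs_neg, Int.natAbs_natCast, and_self]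
    exact summable_geometric_of_lt_one h0.le h1
  exact h.mul_of_nonneg h (fun _ => by positivity) fun _ => by positivity

/-- Changing the signs along the ray costs at most a bounded amount of energy, uniformly in the
size of the box. -/
lemma exists_sum_partIn_le {x : ℝ} (hx : 0 ≤ x) (h : (1 + √2) * x < 1) :
    ∃ C, ∀ (N : ℕ), ∀ t ∈ Set.Ioo (0 : ℝ) 1,
      |(t⁻¹ * ∑ e ∈ (dualTouching N).filter fun e => e.2 = true,
          partIn (dualTouching N) (fun e => interp x t e * sg (ray (1, 1) e)) e) *
            part (dualTouching N) (interp x t) 0 -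
        part (dualTouching N) (fun e => interp x t e * sg (ray (1, 1) e)) 0 *
          (t⁻¹ * ∑ e ∈ (dualTouching N).filter fun e => e.2 = true,
            partIn (dualTouching N) (interp x t) e)| ≤
      C * (|part (dualTouching N) (interp x t) 0| *
        |part (dualTouching N) (fun e => interp x t e * sg (ray (1, 1) e)) 0|) := by
  obtain ⟨ν, hν1, hν0, C, hC0, hC⟩ := exists_energy_comparison hx h
  have hs := summable_pow_natAbs hν0 hν1
  set K := ∑' a : ℤ × ℤ, ν ^ a.1.natAbs * ν ^ a.2.natAbs with hK
  refine ⟨x * (C * ν⁻¹) * K, fun N t ht => ?_⟩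
  set G := dualTouching N with hG
  set Z := part G (interp x t) 0 with hZ
  set Y := part G (fun e => interp x t e * sg (ray (1, 1) e)) 0 with hY
  have hw : ∀ e, |interp x t e| ≤ x := fun e => by
    unfold interp
    split_ifs
    · rw [abs_of_nonneg (mul_nonneg ht.1.le hx)]
      exact mul_le_of_le_one_left hx ht.2.le
    · rw [abs_of_nonneg hx]
  have key : ∀ e ∈ G.filter fun e => e.2 = true,
      |partIn G (fun e => interp x t e * sg (ray (1, 1) e)) e * Z - Y * partIn G (interp x t) e| ≤
        t * (x * (C * ν⁻¹) * (|Z| * |Y|)) *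
          (ν ^ e.1.1.natAbs * ν ^ (e.1.2 + 1).natAbs) := by
    intro e he
    obtain ⟨⟨p, q⟩, b⟩ := e
    obtain rfl : b = true := (Finset.mem_filter.1 he).2
    set a : Site := (p, q + 1) with ha
    have hb : ((p, q), true) = bond a 0 := by simp [bond, ha]
    have hwa : |interp x t (bond a 0)| = t * x := by
      rw [← hb]
      simp only [interp, if_true]
      exact abs_of_nonneg (mul_nonneg ht.1.le hx)
    have hpow : ν ^ (a.1.natAbs + a.2.natAbs - 1) ≤ ν⁻¹ * (ν ^ p.natAbs * ν ^ (q + 1).natAbs) := by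
      rw [inv_mul_eq_div, le_div_iff₀ hν0, ← pow_succ, ← pow_add]
      exact pow_le_pow_of_le_one hν0.le hν1.le (by simp only [ha]; omega)
    have hmain : |Z * partIn G (fun e => interp x t e * sg (ray (1, 1) e)) (bond a 0) -
        Y * partIn G (interp x t) (bond a 0)| ≤ t * x *
          (C * ν ^ (a.1.natAbs + a.2.natAbs - 1) * (|Z| * |Y|)) := by
      rw [← hwa]
      by_cases h1 : 1 ≤ a.1
      · exact hC G _ _ a _ hw fun u i => le_dist'_of_ray h1
      · have := hC G _ _ a _ hw fun u i => le_dist'_of_rightRay (not_le.1 h1)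
        rwa [part_rightRay, partIn_rightRay] at this
    change _ ≤ t * (x * (C * ν⁻¹) * (|Z| * |Y|)) * (ν ^ p.natAbs * ν ^ (q + 1).natAbs)
    rw [hb, mul_comm _ Z]
    refine hmain.trans ?_
    have hR : 0 ≤ |Z| * |Y| := mul_nonneg (abs_nonneg _) (abs_nonneg _)
    generalize |Z| * |Y| = R at hR ⊢
    refine (mul_le_mul_of_nonneg_left (mul_le_mul_of_nonneg_right
      (mul_le_mul_of_nonneg_left hpow hC0.le) hR) (mul_nonneg ht.1.le hx)).trans_eq ?_
    ring
  have hle : ∑ e ∈ G.filter fun e => e.2 = true, ν ^ e.1.1.natAbs * ν ^ (e.1.2 + 1).natAbs ≤ K := by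
    have hinj : Set.InjOn (fun e : Bond => (e.1.1, e.1.2 + 1))
        (G.filter fun e => e.2 = true : Finset Bond) := by
      rintro ⟨⟨p, q⟩, b⟩ he ⟨⟨p', q'⟩, b'⟩ he' heq
      have h1 : b = true := (Finset.mem_filter.1 he).2
      have h2 : b' = true := (Finset.mem_filter.1 he').2
      simp only [Prod.mk.injEq, add_left_inj] at heq
      rw [h1, h2, heq.1, heq.2]
    rw [← Finset.sum_image (f := fun a : ℤ × ℤ => ν ^ a.1.natAbs * ν ^ a.2.natAbs) hinj]
    exact hs.sum_le_tsum _ fun a _ => by positivity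
  clear_value Z Y
  have hR : 0 ≤ |Z| * |Y| := mul_nonneg (abs_nonneg _) (abs_nonneg _)
  rw [mul_assoc, mul_left_comm Y, ← mul_sub, Finset.sum_mul, Finset.mul_sum,
    ← Finset.sum_sub_distrib, abs_mul,
    abs_of_pos (inv_pos.2 ht.1), inv_mul_le_iff₀ ht.1]
  refine (Finset.abs_sum_le_sum_abs _ _).trans ((Finset.sum_le_sum key).trans ?_)
  rw [← Finset.mul_sum]
  refine (mul_le_mul_of_nonneg_left hle ?_).trans_eq (by ring)
  exact mul_nonneg ht.1.le (mul_nonneg (mul_nonneg hx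
    (mul_nonneg hC0.le (inv_nonneg.2 hν0.le))) hR)

lemma continuous_part_interp (G : Finset Bond) (τ : Bond → ZMod 2) (x : ℝ) :
    Continuous fun t => part G (fun e => interp x t e * sg (τ e)) 0 := by
  unfold part
  simp only [prod_mul_sg, prod_interp]
  fun_prop

lemma exists_le_mag {β : ℝ} (h : (1 + √2) * Real.exp (-2 * β) < 1) :
    ∃ c > 0, ∀ N, c ≤ mag 2 N β := by
  set x := Real.exp (-2 * β) with hx
  have hx0 : 0 < x := Real.exp_pos _
  obtain ⟨C, hC⟩ := exists_sum_partIn_le hx0.le h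
  refine ⟨Real.exp (-C), Real.exp_pos _, fun N => ?_⟩
  have hC := hC N
  rw [mag_eq_lowTemp]
  generalize dualTouching N = G at hC ⊢
  have hZ : ∀ t ∈ Set.Icc (0 : ℝ) 1, 0 < part G (interp x t) 0 := fun t ht =>
    part_pos fun e => by
      unfold interp
      split_ifs
      · exact mul_nonneg ht.1 hx0.le
      · exact hx0.le
  have hone : interp x 1 = fun _ => x := by
    ext e
    simp [interp]
  have hcZ : Continuous fun t => part G (interp x t) 0 := by
    simpa [sg_zero] using continuous_part_interp G 0 x
  have hdZ : ∀ t : ℝ, t ≠ 0 → HasDerivAt (fun t => part G (interp x t) 0)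
      (t⁻¹ * ∑ e ∈ G.filter fun e => e.2 = true, partIn G (interp x t) e) t := fun t ht => by
    simpa [sg_zero] using hasDerivAt_part_interp G 0 x ht
  have main := exp_neg_le_of_abs_deriv_le (C := C)
    (h := fun t => part G (fun e => interp x t e * sg (ray (1, 1) e)) 0 / part G (interp x t) 0)
    ((continuous_part_interp G _ x).continuousOn.div hcZ.continuousOn fun t ht => (hZ t ht).ne')
    (fun t ht => (hasDerivAt_part_interp G (ray (1, 1)) x ht.1.ne').fun_div (hdZ t ht.1.ne')
      (hZ t (Set.Ioo_subset_Icc_self ht)).ne')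
    (fun t ht => ?_) ?_
  · simpa only [hone] using main
  · have hC := hC t ht
    have hp := hZ t (Set.Ioo_subset_Icc_self ht)
    rw [abs_div, abs_div, abs_of_pos (pow_pos hp 2), div_le_iff₀ (pow_pos hp 2)]
    refine hC.trans_eq ?_
    rw [abs_of_pos hp]
    field_simp
  · rw [part_interp_zero, div_self (hZ 0 (by simp)).ne']

lemma mag_le_one (N : ℕ) (β : ℝ) : mag 2 N β ≤ 1 := by
  rw [mag_eq_lowTemp]
  have hx := Real.exp_pos (-2 * β)
  generalize Real.exp (-2 * β) = x at hx ⊢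
  refine div_le_one_of_le₀ (Finset.sum_le_sum fun E _ => ?_) (part_pos fun _ => hx.le).le
  rw [prod_mul_sg, Finset.prod_const]
  exact mul_le_of_le_one_right (by positivity) ((le_abs_self _).trans_eq (abs_sg _))

lemma mstar_pos {β : ℝ} (h : (1 / 2) * Real.log (1 + √2) < β) : 0 < mstar 2 β := by
  have hx : (1 + √2) * Real.exp (-2 * β) < 1 := by
    rw [neg_mul, Real.exp_neg, ← div_eq_mul_inv, div_lt_one (Real.exp_pos _),
      ← Real.log_lt_iff_lt_exp (by positivity)]
    linarith
  obtain ⟨c, hc, hle⟩ := exists_le_mag hx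
  refine hc.trans_le (le_limsup_of_frequently_le (Eventually.of_forall hle).frequently ?_)
  exact isBoundedUnder_of ⟨1, fun N => mag_le_one N β⟩

/-- Onsager: the critical point of the 2d Ising model is
`½ log(1+√2) = log √(1+√2)`.  For the two-dimensional Ising model with plus boundary
conditions, the spontaneous magnetisation `m*(β)` vanishes for every
`β < ½ log(1+√2)` and is positive for every `β > ½ log(1+√2)`. -/
theorem ising2d_critical_point :
    (∀ β : ℝ, 0 ≤ β → β < (1 / 2) * Real.log (1 + Real.sqrt 2) → mstar 2 β = 0) ∧
    (∀ β : ℝ, (1 / 2) * Real.log (1 + Real.sqrt 2) < β → 0 < mstar 2 β) := by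
  exact ⟨fun _ h0 h => mstar_eq_zero h0 h, fun _ h => mstar_pos h⟩
end

section
/- For N ≥ 1 let W_N be the (finite, nonempty) set of N-step self-avoiding walks in ℤ²: functions h : {0,1,…,N} → ℤ² with h(0) = (0,0), ‖h(i+1) − h(i)‖₁ = 1 for all 0 ≤ i < N, and h injective. Let E_N denote expectation with respect to the uniform probability measure on W_N, and let ‖·‖ denote the Euclidean norm on ℝ². Then for every real p ≥ 1 and every N ≥ 1, (E_N[‖h(N)‖^p])^{1/p} ≥ (1/6) · N^{p/(2p+2)}. -/
open scoped Classical
open Filter Topology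

noncomputable section

/-- A bounding box for `N`-step walks: functions `{0,…,N} → [-N,N]² ⊆ ℤ²` (every `N`-step
nearest-neighbour walk started at the origin takes values there). -/
def walkBox (N : ℕ) : Finset (Fin (N + 1) → ℤ × ℤ) :=
  Fintype.piFinset fun _ => (Finset.Icc (-(N : ℤ)) N) ×ˢ (Finset.Icc (-(N : ℤ)) N)

/-- `W_N`: the set of `N`-step self-avoiding walks in `ℤ²`, i.e. injective functions
`h : {0,…,N} → ℤ²` with `h 0 = 0` and `‖h(i+1) - h(i)‖₁ = 1` for all `i < N`. -/
def SAW (N : ℕ) : Finset (Fin (N + 1) → ℤ × ℤ) :=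
  (walkBox N).filter fun h =>
    h 0 = (0, 0) ∧
    (∀ i : Fin N,
      |(h i.succ).1 - (h i.castSucc).1| + |(h i.succ).2 - (h i.castSucc).2| = 1) ∧
    Function.Injective h

/-- The Euclidean norm of the endpoint `h(N)` of a walk. -/
def endNorm (N : ℕ) (h : Fin (N + 1) → ℤ × ℤ) : ℝ :=
  Real.sqrt (((h (Fin.last N)).1 : ℝ) ^ 2 + ((h (Fin.last N)).2 : ℝ) ^ 2)

/-- `E_N[‖h(N)‖^p]`: the mean `p`-th power of the endpoint displacement under the uniform
measure on `W_N`. -/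
def meanEndNorm (N : ℕ) (p : ℝ) : ℝ :=
  (∑ h ∈ SAW N, endNorm N h ^ p) / (SAW N).card

end

namespace SelfAvoidingWalk

/-- The four unit vectors of `ℤ²`. -/
def units : Finset (ℤ × ℤ) := {(1, 0), (-1, 0), (0, 1), (0, -1)}

/-- The height of `v` in the direction `e`. -/
def height (e v : ℤ × ℤ) : ℤ := e.1 * v.1 + e.2 * v.2

/-- The reflection across the line of height `M` in the direction `e`. -/
def reflection (e : ℤ × ℤ) (M : ℤ) (v : ℤ × ℤ) : ℤ × ℤ :=
  (v.1 + 2 * (M - height e v) * e.1, v.2 + 2 * (M - height e v) * e.2)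

/-- Folds the plane onto the half-plane of height at most `M` in the direction `e`. -/
def fold (e : ℤ × ℤ) (M : ℤ) (v : ℤ × ℤ) : ℤ × ℤ :=
  if height e v ≤ M then v else reflection e M v

/-- Reflects the part of `h` after time `k` across the line of height `height e (h k)`. -/
def unfold {N : ℕ} (e : ℤ × ℤ) (k : Fin (N + 1)) (h : Fin (N + 1) → ℤ × ℤ) :
    Fin (N + 1) → ℤ × ℤ :=
  fun i => if i ≤ k then h i else reflection e (height e (h k)) (h i)

lemma mem_units {e : ℤ × ℤ} :
    e ∈ units ↔ e = (1, 0) ∨ e = (-1, 0) ∨ e = (0, 1) ∨ e = (0, -1) := by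
  simp [units]

lemma card_units : units.card = 4 := by decide

lemma height_reflection {e : ℤ × ℤ} (he : e ∈ units) (M : ℤ) (v : ℤ × ℤ) :
    height e (reflection e M v) = 2 * M - height e v := by
  rcases mem_units.1 he with rfl | rfl | rfl | rfl <;> simp [height, reflection] <;> ring

lemma reflection_reflection {e : ℤ × ℤ} (he : e ∈ units) (M : ℤ) (v : ℤ × ℤ) :
    reflection e M (reflection e M v) = v := by
  rcases mem_units.1 he with rfl | rfl | rfl | rfl <;>
    ext <;> simp [height, reflection] <;> ring

lemma reflection_of_height_eq {e : ℤ × ℤ} {M : ℤ} {v : ℤ × ℤ} (hv : height e v = M) :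
    reflection e M v = v := by
  simp [reflection, hv]

lemma dist_reflection {e : ℤ × ℤ} (he : e ∈ units) (M : ℤ) (v w : ℤ × ℤ) :
    |(reflection e M v).1 - (reflection e M w).1| +
        |(reflection e M v).2 - (reflection e M w).2| =
      |v.1 - w.1| + |v.2 - w.2| := by
  rcases mem_units.1 he with rfl | rfl | rfl | rfl <;> simp [height, reflection] <;> grind

lemma fold_of_le {e : ℤ × ℤ} {M : ℤ} {v : ℤ × ℤ} (hv : height e v ≤ M) : fold e M v = v :=
  if_pos hv

lemma fold_reflection {e : ℤ × ℤ} (he : e ∈ units) {M : ℤ} {v : ℤ × ℤ}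
    (hv : height e v ≤ M) : fold e M (reflection e M v) = v := by
  rcases hv.eq_or_lt with h | h
  · rw [reflection_of_height_eq h, fold_of_le hv]
  · rw [fold, if_neg (by rw [height_reflection he]; omega), reflection_reflection he]

lemma abs_add_abs_le_of_step {N : ℕ} {h : Fin (N + 1) → ℤ × ℤ} (h0 : h 0 = (0, 0))
    (hs : ∀ i : Fin N,
      |(h i.succ).1 - (h i.castSucc).1| + |(h i.succ).2 - (h i.castSucc).2| = 1)
    (i : Fin (N + 1)) : |(h i).1| + |(h i).2| ≤ (i : ℕ) := by
  induction i using Fin.induction with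
  | zero => simp [h0]
  | succ i ih =>
    have := hs i
    simp only [Fin.val_succ, Fin.val_castSucc] at ih ⊢
    push_cast
    grind

lemma mem_SAW {N : ℕ} {h : Fin (N + 1) → ℤ × ℤ} :
    h ∈ SAW N ↔ h 0 = (0, 0) ∧
      (∀ i : Fin N,
        |(h i.succ).1 - (h i.castSucc).1| + |(h i.succ).2 - (h i.castSucc).2| = 1) ∧
      Function.Injective h := by
  refine ⟨fun hh => (Finset.mem_filter.1 hh).2, fun hh => Finset.mem_filter.2 ⟨?_, hh⟩⟩
  rw [walkBox, Fintype.mem_piFinset]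
  intro i
  have h1 := abs_add_abs_le_of_step hh.1 hh.2.1 i
  have h2 : ((i : ℕ) : ℤ) ≤ N := by have := i.is_lt; omega
  rw [Finset.mem_product, Finset.mem_Icc, Finset.mem_Icc, ← abs_le, ← abs_le]
  constructor
  · linarith [abs_nonneg (h i).2]
  · linarith [abs_nonneg (h i).1]

lemma SAW_nonempty (N : ℕ) : (SAW N).Nonempty := by
  refine ⟨fun i => ((i : ℕ), 0), mem_SAW.2 ⟨by simp, fun i => by simp, fun i j hij => ?_⟩⟩
  simpa [Fin.ext_iff] using hij

section unfold

variable {N : ℕ} {h : Fin (N + 1) → ℤ × ℤ} {e : ℤ × ℤ} {k : Fin (N + 1)}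

lemma fold_unfold (he : e ∈ units) (hk : ∀ i, height e (h i) ≤ height e (h k))
    (i : Fin (N + 1)) : fold e (height e (h k)) (unfold e k h i) = h i := by
  rw [unfold]
  split_ifs
  · exact fold_of_le (hk i)
  · exact fold_reflection he (hk i)

lemma height_unfold_last (he : e ∈ units) :
    height e (unfold e k h (Fin.last N)) =
      2 * height e (h k) - height e (h (Fin.last N)) := by
  rw [unfold]
  split_ifs with hi
  · rw [Fin.last_le_iff.1 hi]; ring
  · rw [height_reflection he]

lemma unfold_mem_SAW (he : e ∈ units) (hk : ∀ i, height e (h i) ≤ height e (h k))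
    (hh : h ∈ SAW N) : unfold e k h ∈ SAW N := by
  obtain ⟨h0, hs, hinj⟩ := mem_SAW.1 hh
  refine mem_SAW.2 ⟨by simp [unfold, h0], fun i => ?_, fun i j hij => hinj ?_⟩
  · rcases lt_trichotomy i.castSucc k with hik | hik | hik
    · have h1 : i.succ ≤ k := Fin.castSucc_lt_iff_succ_le.1 hik
      simpa only [unfold, if_pos hik.le, if_pos h1] using hs i
    · have h1 : ¬ i.succ ≤ k := by rw [← hik, not_le]; exact Fin.castSucc_lt_succ
      have h2 : h i.castSucc = reflection e (height e (h k)) (h i.castSucc) :=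
        (reflection_of_height_eq (by rw [hik])).symm
      simp only [unfold, if_pos hik.le, if_neg h1]
      rw [h2, dist_reflection he]
      exact hs i
    · have h1 : ¬ i.succ ≤ k := by
        rw [not_le]; exact hik.trans Fin.castSucc_lt_succ
      simp only [unfold, if_neg (not_le.2 hik), if_neg h1]
      rw [dist_reflection he]
      exact hs i
  · rw [← fold_unfold he hk i, ← fold_unfold he hk j, hij]

end unfold

/-- Some point of a self-avoiding walk has the largest height among all directions, and by
counting points this height is of order at least `√N`. -/
lemma exists_height_max {N : ℕ} {h : Fin (N + 1) → ℤ × ℤ} (hinj : Function.Injective h) :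
    ∃ e ∈ units, ∃ k, (∀ i, height e (h i) ≤ height e (h k)) ∧ 0 ≤ height e (h k) ∧
      (N : ℤ) + 1 ≤ (2 * height e (h k) + 1) ^ 2 := by
  obtain ⟨⟨e, k⟩, hek, hmax⟩ := (units ×ˢ (Finset.univ : Finset (Fin (N + 1)))).exists_max_image
    (fun q => height q.1 (h q.2)) ⟨((1, 0), 0), by simp [units]⟩
  have hmax' : ∀ e' ∈ units, ∀ i, height e' (h i) ≤ height e (h k) :=
    fun e' he' i => hmax (e', i) (by simpa using he')
  have he : e ∈ units := (Finset.mem_product.1 hek).1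
  set M := height e (h k) with hM
  have h1 := fun i => hmax' (1, 0) (by simp [units]) i
  have h2 := fun i => hmax' (-1, 0) (by simp [units]) i
  have h3 := fun i => hmax' (0, 1) (by simp [units]) i
  have h4 := fun i => hmax' (0, -1) (by simp [units]) i
  simp only [height] at h1 h2 h3 h4
  have hM0 : 0 ≤ M := by have := h1 0; have := h2 0; omega
  refine ⟨e, he, k, hmax' e he, hM0, ?_⟩
  have hcard : (Finset.univ : Finset (Fin (N + 1))).card ≤
      (Finset.Icc (-M) M ×ˢ Finset.Icc (-M) M).card := by
    refine Finset.card_le_card_of_injOn h (fun i _ => ?_) hinj.injOn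
    have := h1 i; have := h2 i; have := h3 i; have := h4 i
    simp only [Finset.coe_product, Finset.coe_Icc, Set.mem_prod, Set.mem_Icc]
    omega
  rw [Finset.card_product, Int.card_Icc, Finset.card_univ, Fintype.card_fin] at hcard
  have hcast : (((M + 1 - -M).toNat : ℕ) : ℤ) = 2 * M + 1 := by omega
  zify at hcard
  rw [hcast] at hcard
  linarith

lemma abs_height_le_endNorm {N : ℕ} {e : ℤ × ℤ} (he : e ∈ units)
    (h : Fin (N + 1) → ℤ × ℤ) : |(height e (h (Fin.last N)) : ℝ)| ≤ endNorm N h := by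
  rw [endNorm]
  apply Real.abs_le_sqrt
  rcases mem_units.1 he with rfl | rfl | rfl | rfl <;> simp [height] <;> positivity

lemma endNorm_nonneg (N : ℕ) (h : Fin (N + 1) → ℤ × ℤ) : 0 ≤ endNorm N h :=
  Real.sqrt_nonneg _

lemma one_le_endNorm {N : ℕ} (hN : 1 ≤ N) {h : Fin (N + 1) → ℤ × ℤ} (hh : h ∈ SAW N) :
    1 ≤ endNorm N h := by
  obtain ⟨h0, -, hinj⟩ := mem_SAW.1 hh
  have hne : h (Fin.last N) ≠ (0, 0) := by
    rw [← h0]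
    intro hc
    have := congrArg Fin.val (hinj hc)
    simp at this
    omega
  rw [endNorm, Real.one_le_sqrt]
  have key : 1 ≤ (h (Fin.last N)).1 ^ 2 + (h (Fin.last N)).2 ^ 2 := by
    by_contra hc
    apply hne
    have ha := sq_nonneg (h (Fin.last N)).1
    have hb := sq_nonneg (h (Fin.last N)).2
    ext
    · exact pow_eq_zero_iff two_ne_zero |>.1 (by omega)
    · exact pow_eq_zero_iff two_ne_zero |>.1 (by omega)
  exact_mod_cast key

/-- Unfolding injects the walks ending within distance `R` of the origin, up to `4 * (2 * R + 1)`
choices, into those ending at distance at least `√N - 1 - R`. -/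
lemma card_near_le (N : ℕ) {R : ℝ} (hR : 0 ≤ R) :
    (((SAW N).filter fun h => endNorm N h < R).card : ℝ) ≤
      ((SAW N).filter fun h => √N - 1 - R ≤ endNorm N h).card * (4 * (2 * R + 1)) := by
  have hex : ∀ h ∈ SAW N, ∃ q : (ℤ × ℤ) × Fin (N + 1), q.1 ∈ units ∧
      (∀ i, height q.1 (h i) ≤ height q.1 (h q.2)) ∧ 0 ≤ height q.1 (h q.2) ∧
      (N : ℤ) + 1 ≤ (2 * height q.1 (h q.2) + 1) ^ 2 := fun h hh => by
    obtain ⟨e, he, k, hk⟩ := exists_height_max (mem_SAW.1 hh).2.2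
    exact ⟨(e, k), he, hk⟩
  choose! q hqu hqmax hq0 hqN using hex
  have hcard := Finset.card_le_card_of_injOn
    (s := (SAW N).filter fun h => endNorm N h < R)
    (t := ((SAW N).filter fun h => √N - 1 - R ≤ endNorm N h) ×ˢ
      (units ×ˢ Finset.Icc (-⌊R⌋) ⌊R⌋))
    (fun h => (unfold (q h).1 (q h).2 h, (q h).1, height (q h).1 (h (Fin.last N))))
    (fun h hh => ?_) (fun h hh h' hh' heq => ?_)
  · rw [Finset.card_product, Finset.card_product, card_units, Int.card_Icc] at hcard
    have hfl : 0 ≤ ⌊R⌋ := Int.floor_nonneg.2 hR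
    have hcast : (((⌊R⌋ + 1 - -⌊R⌋).toNat : ℕ) : ℝ) = 2 * ⌊R⌋ + 1 := by
      have : (((⌊R⌋ + 1 - -⌊R⌋).toNat : ℕ) : ℤ) = 2 * ⌊R⌋ + 1 := by omega
      exact_mod_cast this
    have hcard' : (((SAW N).filter fun h => endNorm N h < R).card : ℝ) ≤
        ((SAW N).filter fun h => √N - 1 - R ≤ endNorm N h).card * (4 * (2 * ⌊R⌋ + 1)) := by
      rw [← hcast]; exact_mod_cast hcard
    refine hcard'.trans ?_
    have := Int.floor_le R
    gcongr
  · rw [Finset.mem_coe, Finset.mem_filter] at hh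
    obtain ⟨hh, hlt⟩ := hh
    have habs := (abs_height_le_endNorm (hqu h hh) h).trans hlt.le
    obtain ⟨hl, hu⟩ := abs_le.1 habs
    rw [Finset.mem_coe, Finset.mem_product, Finset.mem_product, Finset.mem_filter, Finset.mem_Icc]
    refine ⟨⟨unfold_mem_SAW (hqu h hh) (hqmax h hh) hh, ?_⟩, hqu h hh, ?_, ?_⟩
    · refine le_trans ?_ ((le_abs_self _).trans (abs_height_le_endNorm (hqu h hh) _))
      rw [height_unfold_last (hqu h hh)]
      have hM : √(N : ℝ) ≤ 2 * height (q h).1 (h (q h).2) + 1 := by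
        rw [Real.sqrt_le_iff]
        have h0 : (0 : ℝ) ≤ height (q h).1 (h (q h).2) := by exact_mod_cast hq0 h hh
        have h1 : (N : ℝ) + 1 ≤ (2 * height (q h).1 (h (q h).2) + 1) ^ 2 := by
          exact_mod_cast hqN h hh
        constructor <;> linarith
      push_cast
      linarith
    · rw [neg_le, Int.le_floor]
      push_cast
      linarith
    · exact Int.le_floor.2 hu
  · rw [Finset.mem_coe, Finset.mem_filter] at hh hh'
    simp only [Prod.mk.injEq] at heq
    obtain ⟨hw, he, ha⟩ := heq
    have h1 := height_unfold_last (h := h) (k := (q h).2) (hqu h hh.1)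
    have h2 := height_unfold_last (h := h') (k := (q h').2) (hqu h' hh'.1)
    have hM : height (q h).1 (h (q h).2) = height (q h').1 (h' (q h').2) := by
      rw [hw, he] at h1
      rw [he] at ha ⊢
      omega
    funext i
    rw [← fold_unfold (hqu h hh.1) (hqmax h hh.1) i,
      ← fold_unfold (hqu h' hh'.1) (hqmax h' hh'.1) i, hM, hw, he]

lemma card_mul_rpow_le_sum (N : ℕ) {p R : ℝ} (hp : 0 ≤ p) (hR : 0 ≤ R)
    (hT : R ≤ √N - 1 - R) (hTp : R ^ p * (4 * (2 * R + 1) + 1) ≤ (√N - 1 - R) ^ p) :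
    (SAW N).card * R ^ p ≤ ∑ h ∈ SAW N, endNorm N h ^ p := by
  have hpt : ∀ h ∈ SAW N, R ^ p - (if endNorm N h < R then R ^ p else 0) +
      (if √N - 1 - R ≤ endNorm N h then (√N - 1 - R) ^ p - R ^ p else 0) ≤
      endNorm N h ^ p := by
    intro h _
    have hmono : ∀ {x : ℝ}, 0 ≤ x → x ≤ endNorm N h → x ^ p ≤ endNorm N h ^ p :=
      fun hx hle => Real.rpow_le_rpow hx hle hp
    split_ifs with h1 h2 h2
    · linarith
    · simpa using Real.rpow_nonneg (endNorm_nonneg N h) p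
    · simpa using hmono (hR.trans hT) h2
    · simpa using hmono hR (not_lt.1 h1)
  have hsum := Finset.sum_le_sum hpt
  rw [Finset.sum_add_distrib, Finset.sum_sub_distrib, ← Finset.sum_filter, ← Finset.sum_filter,
    Finset.sum_const, Finset.sum_const, Finset.sum_const, nsmul_eq_mul, nsmul_eq_mul,
    nsmul_eq_mul] at hsum
  have hnear := mul_le_mul_of_nonneg_right (card_near_le N hR) (Real.rpow_nonneg hR p)
  have hfar := mul_le_mul_of_nonneg_left hTp
    (Nat.cast_nonneg (α := ℝ) ((SAW N).filter fun h => √N - 1 - R ≤ endNorm N h).card)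
  linarith

lemma le_meanEndNorm_rpow {N : ℕ} {p R : ℝ} (hp : 0 < p) (hR : 0 ≤ R)
    (hsum : (SAW N).card * R ^ p ≤ ∑ h ∈ SAW N, endNorm N h ^ p) :
    R ≤ meanEndNorm N p ^ (1 / p) := by
  have hpos : (0 : ℝ) < (SAW N).card := by exact_mod_cast (SAW_nonempty N).card_pos
  have hmean : R ^ p ≤ meanEndNorm N p := by
    rw [meanEndNorm, le_div_iff₀ hpos]
    linarith
  calc R = (R ^ p) ^ (1 / p) := by rw [one_div, Real.rpow_rpow_inv hR hp.ne']
    _ ≤ _ := Real.rpow_le_rpow (Real.rpow_nonneg hR p) hmean (by positivity)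

end SelfAvoidingWalk

/-- Madras's lower bound.  For the uniform measure on `N`-step
self-avoiding walks in `ℤ²` and every `p ≥ 1`, `(E_N[‖h(N)‖^p])^{1/p} ≥ (1/6) N^{p/(2p+2)}`. -/
theorem saw_endpoint_lower_bound (p : ℝ) (hp : 1 ≤ p) (N : ℕ) (hN : 1 ≤ N) :
    (1 / 6 : ℝ) * (N : ℝ) ^ (p / (2 * p + 2)) ≤ meanEndNorm N p ^ (1 / p) := by
  have hp0 : 0 < p := by linarith
  set R : ℝ := (1 / 6 : ℝ) * (N : ℝ) ^ (p / (2 * p + 2)) with hRdef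
  have hR : 0 ≤ R := by positivity
  clear_value R
  apply SelfAvoidingWalk.le_meanEndNorm_rpow hp0 hR
  rcases le_total R 1 with hR1 | hR1
  · rw [← nsmul_eq_mul]
    refine Finset.card_nsmul_le_sum _ _ _ fun h hh => ?_
    exact Real.rpow_le_rpow hR (hR1.trans (SelfAvoidingWalk.one_le_endNorm hN hh)) hp0.le
  · have hsqrt : √(N : ℝ) = 6 * R * (6 * R) ^ (1 / p) := by
      have h6 : 6 * R = (N : ℝ) ^ (p / (2 * p + 2)) := by rw [hRdef]; ring
      have hN0 : (0 : ℝ) < N := by exact_mod_cast hN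
      rw [h6, ← Real.rpow_mul hN0.le, ← Real.rpow_add hN0, Real.sqrt_eq_rpow]
      congr 1
      field_simp
    have hroot : 1 ≤ (6 * R) ^ (1 / p) := Real.one_le_rpow (by linarith) (by positivity)
    have hT : R * (4 * (6 * R) ^ (1 / p)) ≤ √(N : ℝ) - 1 - R := by
      rw [hsqrt]
      nlinarith
    apply SelfAvoidingWalk.card_mul_rpow_le_sum N hp0.le hR
    · nlinarith
    · refine le_trans ?_ (Real.rpow_le_rpow (by positivity) hT hp0.le)
      rw [Real.mul_rpow hR (by positivity), Real.mul_rpow (by norm_num) (by positivity),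
        one_div, Real.rpow_inv_rpow (by positivity) hp0.ne']
      have h4 : (4 : ℝ) ≤ 4 ^ p := Real.self_le_rpow_of_one_le (by norm_num) hp
      gcongr
      nlinarith
end
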